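/- arXiv:1008.3579 — 6 statements merged into one kernel-verified Lean document; each statement's English description precedes it below -/
import Mathlib

section
/- Let n ≥ 2, let K ⊆ ℂ be a number field (a subfield of ℂ finite-dimensional over ℚ) with ring of integers 𝓞_K, let b ∈ 𝓞_K be nonzero, and let 𝓞_{K,b} = 𝓞_K[1/b] ⊆ ℂ. Let Γ be a finitely generated subgroup of SL_n(ℂ) such that Γ ∩ SL_n(𝓞_{K,b}) has finite index in Γ. Then Γ is residually finite and for every finite generating set Y of Γ one has F_{Γ,Y}(N) ≼ N^{n²−1}. (Theorem 1.2 instantiated at G = SL_n.) -/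
open scoped Pointwise

section FarbDefs

variable {G : Type*} [Group G]

/-- Word length of `g` with respect to a generating set `X` (symmetrized). -/
noncomputable def wordLength (X : Set G) (g : G) : ℕ :=
  sInf {n | ∃ l : List G, l.length = n ∧ (∀ x ∈ l, x ∈ X ∨ x⁻¹ ∈ X) ∧ l.prod = g}

/-- `farbD g` is the minimal cardinality of a finite quotient of `G` detecting `g`. -/
noncomputable def farbD (g : G) : ℕ :=
  sInf {k | ∃ N : Subgroup G, N.Normal ∧ N.FiniteIndex ∧ g ∉ N ∧ N.index = k}

/-- The normal Farb growth function of `G` with respect to `X`. -/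
noncomputable def farbF (X : Set G) (n : ℕ) : ℕ :=
  sSup {d | ∃ g : G, g ≠ 1 ∧ wordLength X g ≤ n ∧ farbD g = d}

/-- The auxiliary function `F^k`. -/
noncomputable def farbFk (k : ℕ) (X : Set G) (n : ℕ) : ℕ :=
  sSup {d | ∃ g : G, g ^ k ≠ 1 ∧ wordLength X g ≤ n ∧ farbD (g ^ k) = d}

/-- `f ≼ g` : there is `M` with `f n ≤ M * g (M * n)` for all `n`. -/
def FarbPreceq (f g : ℕ → ℕ) : Prop := ∃ M : ℕ, 0 < M ∧ ∀ n, f n ≤ M * g (M * n)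

/-- `f ≈ g`. -/
def FarbEquiv (f g : ℕ → ℕ) : Prop := FarbPreceq f g ∧ FarbPreceq g f

/-- A group is residually finite if every nontrivial element is detected by a
finite quotient. -/
def ResiduallyFinite (G : Type*) [Group G] : Prop :=
  ∀ g : G, g ≠ 1 → ∃ N : Subgroup G, N.Normal ∧ N.FiniteIndex ∧ g ∉ N

end FarbDefs


/-- The ring of integers of a subfield `K` of `ℂ`, as a subring of `ℂ`. -/
def ringOfIntegersIn (K : Subfield ℂ) : Subring ℂ :=
  (integralClosure ℤ ℂ).toSubring ⊓ K.toSubring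

/-- The subring `O[1/b]` of `ℂ` generated by a subring `O` and `1/b`. -/
def awayIn (O : Subring ℂ) (b : ℂ) : Subring ℂ :=
  Subring.closure ((O : Set ℂ) ∪ {b⁻¹})

/-- `SL_m(R)` for a subring `R ⊆ ℂ`, as a subgroup of `SL_m(ℂ)`. -/
def slOver (m : ℕ) (R : Subring ℂ) : Subgroup (Matrix.SpecialLinearGroup (Fin m) ℂ) :=
  (Matrix.SpecialLinearGroup.map R.subtype).range

section LatticeBox

variable {R : Type*} [CommRing R] {ι : Type*} [Fintype ι]

/-- The number of integer vectors `a` with `0 ≤ a i < y` such that `c + ∑ i, a i • ω i` lies in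
the ideal `I`. -/
noncomputable def boxCount (ω : Module.Basis ι ℤ R) (c : R) (y : ℕ) (I : Ideal R) : ℕ := by
  classical
  exact ((Fintype.piFinset fun _ : ι => Finset.Ico (0 : ℤ) y).filter
    fun a => c + ω.equivFun.symm a ∈ I).card

/-- Coordinates of a product are bounded in terms of the coordinates of the factors. -/
lemma exists_coord_mul_le (ω : Module.Basis ι ℤ R) :
    ∃ M : ℕ, 0 < M ∧ ∀ (α β : R) (s t : ℤ), (∀ i, |ω.equivFun α i| ≤ s) →
      (∀ i, |ω.equivFun β i| ≤ t) → ∀ i, |ω.equivFun (α * β) i| ≤ M * (s * t) := by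
  classical
  let m : ι → ι → ι → ℤ := fun i j k => ω.equivFun (ω i * ω j) k
  let M : ℤ := ∑ i, ∑ j, ∑ k, |m i j k|
  have hM : 0 ≤ M := by positivity
  refine ⟨M.toNat + 1, by omega, fun α β s t hα hβ k => ?_⟩
  have hk : ∑ i, ∑ j, |m i j k| ≤ M :=
    Finset.sum_le_sum fun i _ => Finset.sum_le_sum fun j _ =>
      Finset.single_le_sum (f := fun k => |m i j k|) (fun _ _ => abs_nonneg _) (Finset.mem_univ k)
  have h1 : α * β = ∑ i, ∑ j, (ω.equivFun α i * ω.equivFun β j) • (ω i * ω j) := by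
    conv_lhs => rw [← ω.sum_equivFun α, ← ω.sum_equivFun β]
    rw [Finset.sum_mul_sum]
    refine Finset.sum_congr rfl fun i _ => Finset.sum_congr rfl fun j _ => ?_
    rw [smul_mul_smul_comm]
  have h2 : ω.equivFun (α * β) k = ∑ i, ∑ j, (ω.equivFun α i * ω.equivFun β j) * m i j k := by
    rw [h1]
    simp only [map_sum, map_smul, Finset.sum_apply, Pi.smul_apply, smul_eq_mul, m]
  have hst : 0 ≤ s * t :=
    mul_nonneg ((abs_nonneg _).trans (hα k)) ((abs_nonneg _).trans (hβ k))
  rw [h2]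
  calc |∑ i, ∑ j, (ω.equivFun α i * ω.equivFun β j) * m i j k|
      ≤ ∑ i, ∑ j, |(ω.equivFun α i * ω.equivFun β j) * m i j k| :=
        (Finset.abs_sum_le_sum_abs _ _).trans
          (Finset.sum_le_sum fun i _ => Finset.abs_sum_le_sum_abs _ _)
    _ ≤ ∑ i, ∑ j, (s * t) * |m i j k| := by
        refine Finset.sum_le_sum fun i _ => Finset.sum_le_sum fun j _ => ?_
        rw [abs_mul, abs_mul]
        have := mul_le_mul (hα i) (hβ j) (abs_nonneg _) ((abs_nonneg _).trans (hα i))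
        gcongr
    _ = (∑ i, ∑ j, |m i j k|) * (s * t) := by
        simp only [← Finset.mul_sum]
        ring
    _ ≤ M * (s * t) := by gcongr
    _ ≤ ((M.toNat + 1 : ℕ) : ℤ) * (s * t) := by
        gcongr
        push_cast
        omega

variable [IsDedekindDomain R] [Module.Free ℤ R] [Module.Finite ℤ R]

lemma absNorm_pos_of_ne_bot {I : Ideal R} (hI : I ≠ ⊥) : 0 < Ideal.absNorm I :=
  Nat.pos_of_ne_zero fun h => hI (Ideal.absNorm_eq_zero_iff.mp h)

lemma finite_quotient_of_ne_bot {I : Ideal R} (hI : I ≠ ⊥) : Finite (R ⧸ I) := by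
  have h := absNorm_pos_of_ne_bot hI
  rw [Ideal.absNorm_apply, Submodule.cardQuot_apply] at h
  exact Nat.finite_of_card_ne_zero h.ne'

/-- A nonzero ideal of small norm contains a nonzero element with small coordinates. -/
lemma exists_mem_ideal_small_coord (ω : Module.Basis ι ℤ R) {I : Ideal R} (hI : I ≠ ⊥) {t : ℕ}
    (ht : Ideal.absNorm I < (t + 1) ^ Fintype.card ι) :
    ∃ α ∈ I, α ≠ 0 ∧ ∀ i, |ω.equivFun α i| ≤ t := by
  classical
  have := finite_quotient_of_ne_bot hI
  have := Fintype.ofFinite (R ⧸ I)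
  let B := Fintype.piFinset fun _ : ι => Finset.Ico (0 : ℤ) ((t : ℤ) + 1)
  have hB : B.card = (t + 1) ^ Fintype.card ι := by
    simp only [B, Fintype.card_piFinset, Int.card_Ico, Finset.prod_const, Finset.card_univ]
    congr 1
  have hc : (Finset.univ : Finset (R ⧸ I)).card < B.card := by
    rw [hB, Finset.card_univ, ← Nat.card_eq_fintype_card]
    rwa [Ideal.absNorm_apply, Submodule.cardQuot_apply] at ht
  obtain ⟨a, ha, b, hb, hab, h⟩ := Finset.exists_ne_map_eq_of_card_lt_of_maps_to hc
    (f := fun a : ι → ℤ => Ideal.Quotient.mk I (ω.equivFun.symm a)) (fun _ _ => Finset.mem_univ _)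
  refine ⟨ω.equivFun.symm (a - b), ?_, ?_, fun i => ?_⟩
  · rw [map_sub]
    exact Ideal.Quotient.eq.mp h
  · exact fun h0 => hab (sub_eq_zero.mp ((map_eq_zero_iff _ ω.equivFun.symm.injective).mp h0))
  · have h1 := Fintype.mem_piFinset.mp ha i
    have h2 := Fintype.mem_piFinset.mp hb i
    simp only [Finset.mem_Ico] at h1 h2
    rw [LinearEquiv.apply_symm_apply, Pi.sub_apply, abs_le]
    omega

/-- Every residue class modulo an ideal has a representative whose coordinates are bounded by a
constant times the `d`-th root of the norm of the ideal. -/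
lemma exists_small_representatives (ω : Module.Basis ι ℤ R) :
    ∃ M : ℕ, 0 < M ∧ ∀ (I : Ideal R), I ≠ ⊥ → ∀ t : ℕ,
      Ideal.absNorm I < (t + 1) ^ Fintype.card ι →
      ∃ r : R ⧸ I → R, (∀ κ, Ideal.Quotient.mk I (r κ) = κ) ∧
        ∀ κ i, |ω.equivFun (r κ) i| ≤ ((M * t : ℕ) : ℤ) := by
  obtain ⟨M, hM, hmul⟩ := exists_coord_mul_le ω
  refine ⟨M, hM, fun I hI t ht => ?_⟩
  obtain ⟨α, hαI, hα0, hα⟩ := exists_mem_ideal_small_coord ω hI ht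
  have key : ∀ z : R, ∃ w : R, z - w ∈ I ∧ ∀ i, |ω.equivFun w i| ≤ ((M * t : ℕ) : ℤ) := by
    intro z
    have hspan : Ideal.span {α} ≠ ⊥ := by simpa using hα0
    set n := Ideal.absNorm (Ideal.span {α}) with hn
    have hn0 : 0 < n := absNorm_pos_of_ne_bot hspan
    obtain ⟨α', hα'⟩ := Ideal.mem_span_singleton'.mp (Ideal.absNorm_mem (Ideal.span {α}))
    rw [← hn] at hα'
    set u := α' * z with hu
    set v : R := ω.equivFun.symm fun i => ω.equivFun u i % n with hv
    set w : R := ω.equivFun.symm fun i => ω.equivFun u i / n with hw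
    have huvw : u = (n : R) * w + v := by
      apply ω.equivFun.injective
      have : (n : R) * w = (n : ℤ) • w := by simp
      rw [this, map_add, map_smul, hv, hw, LinearEquiv.apply_symm_apply,
        LinearEquiv.apply_symm_apply]
      ext i
      simp only [Pi.add_apply, Pi.smul_apply, smul_eq_mul]
      rw [add_comm]
      exact (Int.emod_add_mul_ediv _ _).symm
    refine ⟨z - α * w, by simpa using I.mul_mem_right w hαI, fun i => ?_⟩
    have h1 : (n : ℤ) • (z - α * w) = α * v := by
      have : (n : R) * z = α * u := by rw [← hα', hu]; ring
      rw [zsmul_eq_mul, Int.cast_natCast, mul_sub, this, huvw]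
      ring
    have h2 := hmul α v t n hα (fun j => by
      rw [hv, LinearEquiv.apply_symm_apply]
      have := Int.emod_nonneg (ω.equivFun u j) (by omega : (n : ℤ) ≠ 0)
      have := Int.emod_lt_of_pos (ω.equivFun u j) (by omega : (0 : ℤ) < n)
      rw [abs_le]
      omega) i
    rw [← h1, map_smul, Pi.smul_apply, smul_eq_mul, abs_mul, Nat.abs_cast] at h2
    have : (n : ℤ) * |ω.equivFun (z - α * w) i| ≤ n * ((M * t : ℕ) : ℤ) := by
      push_cast
      linarith
    exact le_of_mul_le_mul_left this (by omega)
  choose f hf1 hf2 using key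
  refine ⟨fun κ => f (Quotient.out κ), fun κ => ?_, fun κ i => hf2 _ i⟩
  have := Ideal.Quotient.eq.mpr (hf1 (Quotient.out κ))
  rw [← this]
  exact Quotient.out_eq κ

/-- Counting the points of an ideal in a box, given small representatives of the residue classes. -/
lemma boxCount_bounds (ω : Module.Basis ι ℤ R) {I : Ideal R} (hI : I ≠ ⊥) {s : ℕ}
    (r : R ⧸ I → R) (hr : ∀ κ, Ideal.Quotient.mk I (r κ) = κ)
    (hs : ∀ κ i, |ω.equivFun (r κ) i| ≤ s) (c : R) (y : ℕ) :
    boxCount ω c y I * Ideal.absNorm I ≤ (y + 2 * s) ^ Fintype.card ι ∧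
      (y - 2 * s) ^ Fintype.card ι ≤ boxCount ω c y I * Ideal.absNorm I := by
  classical
  have := finite_quotient_of_ne_bot hI
  have := Fintype.ofFinite (R ⧸ I)
  set F := (Fintype.piFinset fun _ : ι => Finset.Ico (0 : ℤ) y).filter
    (fun a => c + ω.equivFun.symm a ∈ I) with hF
  have hprod : boxCount ω c y I * Ideal.absNorm I
      = (F ×ˢ (Finset.univ : Finset (R ⧸ I))).card := by
    rw [Finset.card_product, Finset.card_univ, ← Nat.card_eq_fintype_card, Ideal.absNorm_apply,
      Submodule.cardQuot_apply, hF, boxCount]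
  have hbox : ∀ l u : ℤ, (Fintype.piFinset fun _ : ι => Finset.Ico l u).card
      = (u - l).toNat ^ Fintype.card ι := by
    intro l u
    simp [Fintype.card_piFinset]
  rw [hprod]
  constructor
  · have h := Finset.card_le_card_of_injOn
      (s := F ×ˢ (Finset.univ : Finset (R ⧸ I)))
      (t := Fintype.piFinset fun _ : ι => Finset.Ico (-(s : ℤ)) (y + s))
      (fun p => p.1 + ω.equivFun (r p.2)) ?_ ?_
    · rw [hbox] at h
      refine h.trans (le_of_eq ?_)
      congr 1
      omega
    · rintro ⟨a, κ⟩ hp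
      simp only [Finset.coe_product, Set.mem_prod, Finset.mem_coe, hF, Finset.mem_filter,
        Fintype.mem_piFinset, Finset.mem_Ico] at hp ⊢
      intro i
      have h1 := hp.1.1 i
      have h2 := abs_le.mp (hs κ i)
      rw [Pi.add_apply]
      omega
    · rintro ⟨a, κ⟩ hp ⟨a', κ'⟩ hp' h
      simp only [Finset.coe_product, Set.mem_prod, Finset.mem_coe, hF, Finset.mem_filter] at hp hp'
      dsimp only at h
      have h' := congrArg ω.equivFun.symm h
      rw [map_add, map_add, LinearEquiv.symm_apply_apply, LinearEquiv.symm_apply_apply] at h'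
      have hκ : κ = κ' := by
        rw [← hr κ, ← hr κ', Ideal.Quotient.eq]
        have := I.sub_mem hp'.1.2 hp.1.2
        convert this using 1
        linear_combination h'
      subst hκ
      simpa using h
  · have h := Finset.card_le_card_of_injOn
      (s := Fintype.piFinset fun _ : ι => Finset.Ico (s : ℤ) (y - s))
      (t := F ×ˢ (Finset.univ : Finset (R ⧸ I)))
      (fun z => (z - ω.equivFun (r (Ideal.Quotient.mk I (c + ω.equivFun.symm z))),
        Ideal.Quotient.mk I (c + ω.equivFun.symm z))) ?_ ?_
    · rw [hbox] at h
      refine le_trans (le_of_eq ?_) h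
      congr 1
      omega
    · intro z hz
      simp only [Finset.coe_product, Set.mem_prod, Finset.mem_coe, hF, Finset.mem_filter,
        Fintype.mem_piFinset, Finset.mem_Ico, Finset.mem_univ, and_true] at hz ⊢
      refine ⟨fun i => ?_, ?_⟩
      · have h1 := hz i
        have h2 := abs_le.mp (hs (Ideal.Quotient.mk I (c + ω.equivFun.symm z)) i)
        rw [Pi.sub_apply]
        omega
      · rw [map_sub, LinearEquiv.symm_apply_apply, ← add_sub_assoc, ← Ideal.Quotient.eq, hr]
    · intro z _ z' _ h
      simp only [Prod.mk.injEq] at h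
      have h1 := h.1
      rw [h.2] at h1
      exact sub_left_injective h1

end LatticeBox

section LatticeBoxReal

variable {R : Type*} [CommRing R] [IsDedekindDomain R] [Module.Free ℤ R] [Module.Finite ℤ R]
  {ι : Type*} [Fintype ι]

/-- The number of points of an ideal in a box, up to an error of lower order. -/
lemma exists_boxCount_bounds [Nonempty ι] (ω : Module.Basis ι ℤ R) :
    ∃ C : ℝ, 1 ≤ C ∧ ∀ (c : R) (y : ℕ), 1 ≤ y → ∀ I : Ideal R, I ≠ ⊥ →
      (boxCount ω c y I : ℝ) * Ideal.absNorm I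
        ≤ (y + C * (Ideal.absNorm I : ℝ) ^ (1 / (Fintype.card ι : ℝ))) ^ Fintype.card ι ∧
      (y : ℝ) ^ Fintype.card ι * (1 - C * ((Ideal.absNorm I : ℝ) ^ (1 / (Fintype.card ι : ℝ)) / y))
        ≤ (boxCount ω c y I : ℝ) * Ideal.absNorm I := by
  obtain ⟨M, hM, hrep⟩ := exists_small_representatives ω
  set D := Fintype.card ι with hD
  have hD1 : 1 ≤ D := Fintype.card_pos
  have hM1 : (1 : ℝ) ≤ M := by exact_mod_cast hM
  have hD1' : (1 : ℝ) ≤ D := by exact_mod_cast hD1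
  refine ⟨2 * M * D, by nlinarith, fun c y hy I hI => ?_⟩
  set q := Ideal.absNorm I with hq
  set u : ℝ := (q : ℝ) ^ (1 / (D : ℝ)) with hu
  have hu0 : 0 ≤ u := by positivity
  have huD : u ^ D = q := by
    rw [hu, one_div]
    exact Real.rpow_inv_natCast_pow (by positivity) (by omega)
  set t := ⌊u⌋₊ with ht
  have htu : (t : ℝ) ≤ u := Nat.floor_le hu0
  have hqt : q < (t + 1) ^ D := by
    have : (q : ℝ) < ((t : ℝ) + 1) ^ D := by
      rw [← huD]
      exact pow_lt_pow_left₀ (Nat.lt_floor_add_one u) hu0 (by omega)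
    exact_mod_cast this
  obtain ⟨r, hr, hs⟩ := hrep I hI t hqt
  obtain ⟨h1, h2⟩ := boxCount_bounds ω hI r hr hs c y
  rw [← hq, ← hD] at h1 h2
  have hy0 : (0 : ℝ) < y := by exact_mod_cast hy
  have hMt : 2 * (M * t : ℝ) ≤ 2 * M * D * u := by
    have : (M : ℝ) * t ≤ M * u := by gcongr
    have : (M : ℝ) * u ≤ M * u * D := le_mul_of_one_le_right (by positivity) hD1'
    nlinarith
  constructor
  · have h1' : (boxCount ω c y I : ℝ) * q ≤ (y + 2 * (M * t : ℝ)) ^ D := by exact_mod_cast h1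
    refine h1'.trans ?_
    gcongr
  · have h2' : (((y - 2 * (M * t) : ℕ) : ℝ)) ^ D ≤ (boxCount ω c y I : ℝ) * q := by
      exact_mod_cast h2
    refine le_trans ?_ h2'
    have hvu : D * (2 * (M * t : ℝ) / y) ≤ 2 * M * D * (u / y) := by
      calc D * (2 * (M * t : ℝ) / y) = 2 * M * D * (t / y) := by ring
        _ ≤ _ := by gcongr
    have hle : (y : ℝ) ^ D * (1 - 2 * M * D * (u / y))
        ≤ (y : ℝ) ^ D * (1 - D * (2 * (M * t : ℝ) / y)) := by gcongr
    refine hle.trans ?_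
    by_cases hyt : 2 * (M * t) ≤ y
    · have hyt' : 2 * (M * t : ℝ) ≤ y := by exact_mod_cast hyt
      have hv : 2 * (M * t : ℝ) / y ≤ 1 := (div_le_one hy0).mpr hyt'
      have hb := one_add_mul_le_pow (a := -(2 * (M * t : ℝ) / y)) (by linarith) D
      rw [Nat.cast_sub hyt]
      push_cast
      calc (y : ℝ) ^ D * (1 - D * (2 * (M * t : ℝ) / y))
          ≤ (y : ℝ) ^ D * (1 + -(2 * (M * t : ℝ) / y)) ^ D := by
            gcongr
            linarith
        _ = (y - 2 * (M * t : ℝ)) ^ D := by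
            rw [← mul_pow]
            congr 1
            field_simp
            ring
    · have hyt' : (y : ℝ) ≤ 2 * (M * t : ℝ) := by
        push Not at hyt
        exact_mod_cast hyt.le
      have hv : 1 ≤ 2 * (M * t : ℝ) / y := (one_le_div hy0).mpr hyt'
      have : (y : ℝ) ^ D * (1 - D * (2 * (M * t : ℝ) / y)) ≤ 0 :=
        mul_nonpos_of_nonneg_of_nonpos (by positivity) (by nlinarith)
      exact this.trans (by positivity)

end LatticeBoxReal

section NormBounds

open NumberField

variable {K : Type*} [Field K] [NumberField K]

lemma absNorm_span_singleton_eq_prod (z : 𝓞 K) :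
    (Ideal.absNorm (Ideal.span {z}) : ℝ) = ∏ σ : K →ₐ[ℚ] ℂ, ‖σ (z : K)‖ := by
  have h := Algebra.norm_eq_prod_embeddings ℚ ℂ (z : K)
  rw [← norm_prod, ← h, Ideal.absNorm_span_singleton, ← Algebra.coe_norm_int]
  simp [Nat.cast_natAbs]

lemma absNorm_span_singleton_le {z : 𝓞 K} {B : ℝ} (h : ∀ σ : K →ₐ[ℚ] ℂ, ‖σ (z : K)‖ ≤ B) :
    (Ideal.absNorm (Ideal.span {z}) : ℝ) ≤ B ^ Module.finrank ℚ K := by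
  rw [absNorm_span_singleton_eq_prod, ← AlgHom.card ℚ K ℂ, ← Finset.card_univ,
    ← Finset.prod_const]
  exact Finset.prod_le_prod (fun _ _ => norm_nonneg _) fun σ _ => h σ

lemma le_absNorm_span_singleton {z : 𝓞 K} {B : ℝ} (hB : 0 ≤ B)
    (h : ∀ σ : K →ₐ[ℚ] ℂ, B ≤ ‖σ (z : K)‖) :
    B ^ Module.finrank ℚ K ≤ (Ideal.absNorm (Ideal.span {z}) : ℝ) := by
  rw [absNorm_span_singleton_eq_prod, ← AlgHom.card ℚ K ℂ, ← Finset.card_univ,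
    ← Finset.prod_const]
  exact Finset.prod_le_prod (fun _ _ => hB) fun σ _ => h σ

/-- The elements of a box which is shifted far away have norm comparable to its volume. -/
lemma exists_shift_norm_bounds {ι : Type*} [Fintype ι] (ω : Module.Basis ι ℤ (𝓞 K)) :
    ∃ (k : ℕ) (C : ℝ), 1 ≤ C ∧ ∀ (y : ℕ) (a : ι → ℤ),
      (∀ i, 0 ≤ a i ∧ a i < y) →
      (y : ℝ) ^ Module.finrank ℚ K
        ≤ Ideal.absNorm (Ideal.span {((k * y : ℕ) : 𝓞 K) + ω.equivFun.symm a}) ∧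
      (Ideal.absNorm (Ideal.span {((k * y : ℕ) : 𝓞 K) + ω.equivFun.symm a}) : ℝ)
        ≤ C * (y : ℝ) ^ Module.finrank ℚ K := by
  let B : ℝ := ∑ i, ∑ σ : K →ₐ[ℚ] ℂ, ‖σ (ω i : K)‖
  have hB : 0 ≤ B := by positivity
  obtain ⟨k, hk⟩ := exists_nat_ge (B + 1)
  refine ⟨k, (k + B) ^ Module.finrank ℚ K, one_le_pow₀ (by linarith), fun y a ha => ?_⟩
  have hσ : ∀ σ : K →ₐ[ℚ] ℂ, ‖σ ((ω.equivFun.symm a : 𝓞 K) : K)‖ ≤ y * B := by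
    intro σ
    rw [Module.Basis.equivFun_symm_apply]
    simp only [map_sum, zsmul_eq_mul, map_mul, map_intCast]
    refine (norm_sum_le _ _).trans ?_
    rw [Finset.mul_sum]
    refine Finset.sum_le_sum fun i _ => ?_
    rw [norm_mul]
    have h1 : ‖((a i : ℤ) : ℂ)‖ ≤ y := by
      rw [Complex.norm_intCast, abs_of_nonneg (by exact_mod_cast (ha i).1)]
      exact_mod_cast (ha i).2.le
    have h2 : ‖σ (ω i : K)‖ ≤ ∑ σ : K →ₐ[ℚ] ℂ, ‖σ (ω i : K)‖ :=
      Finset.single_le_sum (f := fun σ : K →ₐ[ℚ] ℂ => ‖σ (ω i : K)‖)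
        (fun _ _ => norm_nonneg _) (Finset.mem_univ σ)
    gcongr
  have hσ' : ∀ σ : K →ₐ[ℚ] ℂ,
      σ ((((k * y : ℕ) : 𝓞 K) + ω.equivFun.symm a : 𝓞 K) : K)
        = ((k * y : ℕ) : ℂ) + σ ((ω.equivFun.symm a : 𝓞 K) : K) := by
    intro σ
    simp
  have hy : (0 : ℝ) ≤ y := Nat.cast_nonneg y
  constructor
  · refine le_absNorm_span_singleton hy fun σ => ?_
    rw [hσ']
    have h1 := norm_sub_norm_le ((k * y : ℕ) : ℂ) (-σ ((ω.equivFun.symm a : 𝓞 K) : K))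
    rw [norm_neg, sub_neg_eq_add, Complex.norm_natCast] at h1
    have h2 := hσ σ
    push_cast at h1 ⊢
    nlinarith
  · rw [← mul_pow]
    refine absNorm_span_singleton_le fun σ => ?_
    rw [hσ']
    refine (norm_add_le _ _).trans ?_
    rw [Complex.norm_natCast]
    have h2 := hσ σ
    push_cast
    linarith

end NormBounds

section Primes

open NumberField

variable (K : Type*) [Field K] [NumberField K]

/-- The nonzero prime ideals of norm at most `n`. -/
noncomputable def primesUpTo (n : ℕ) : Finset (Ideal (𝓞 K)) := by
  classical
  exact (Ideal.finite_setOfPred_absNorm_le (S := 𝓞 K) n).toFinset.filter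
    fun P => P.IsPrime ∧ P ≠ ⊥

/-- The sum of `log N(𝔭)` over the prime ideals of norm at most `n`. -/
noncomputable def idealTheta (n : ℕ) : ℝ :=
  ∑ P ∈ primesUpTo K n, Real.log (Ideal.absNorm P)

variable {K}

lemma mem_primesUpTo {n : ℕ} {P : Ideal (𝓞 K)} :
    P ∈ primesUpTo K n ↔ Ideal.absNorm P ≤ n ∧ P.IsPrime ∧ P ≠ ⊥ := by
  simp [primesUpTo]

lemma primesUpTo_mono {m n : ℕ} (h : m ≤ n) : primesUpTo K m ⊆ primesUpTo K n := by
  intro P hP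
  rw [mem_primesUpTo] at hP ⊢
  exact ⟨hP.1.trans h, hP.2⟩

lemma two_le_absNorm_of_isPrime {P : Ideal (𝓞 K)} (hP : P.IsPrime) (h0 : P ≠ ⊥) :
    2 ≤ Ideal.absNorm P := by
  have h1 := absNorm_pos_of_ne_bot h0
  have h2 : Ideal.absNorm P ≠ 1 := fun h => hP.ne_top (Ideal.absNorm_eq_one_iff.mp h)
  omega

lemma two_le_absNorm_of_mem {n : ℕ} {P : Ideal (𝓞 K)} (hP : P ∈ primesUpTo K n) :
    2 ≤ Ideal.absNorm P := by
  rw [mem_primesUpTo] at hP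
  exact two_le_absNorm_of_isPrime hP.2.1 hP.2.2

lemma log_absNorm_nonneg (I : Ideal (𝓞 K)) : 0 ≤ Real.log (Ideal.absNorm I) :=
  Real.log_natCast_nonneg _

/-- The primes dividing an ideal contribute at most its norm. -/
lemma sum_log_absNorm_le {I : Ideal (𝓞 K)} (hI : I ≠ ⊥) (S : Finset (Ideal (𝓞 K)))
    (hS : ∀ P ∈ S, P.IsPrime ∧ P ≠ ⊥ ∧ I ≤ P) :
    ∑ P ∈ S, Real.log (Ideal.absNorm P) ≤ Real.log (Ideal.absNorm I) := by
  have hdvd : ∏ P ∈ S, P ∣ I := Finset.prod_primes_dvd I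
    (fun P hP => Ideal.prime_of_isPrime (hS P hP).2.1 (hS P hP).1)
    (fun P hP => Ideal.dvd_iff_le.mpr (hS P hP).2.2)
  have h1 := Nat.le_of_dvd (absNorm_pos_of_ne_bot hI) (map_dvd Ideal.absNorm hdvd)
  rw [map_prod] at h1
  rw [← Real.log_prod (fun P hP => by
    have := absNorm_pos_of_ne_bot (hS P hP).2.1
    positivity)]
  apply Real.log_le_log
  · exact Finset.prod_pos fun P hP => by exact_mod_cast absNorm_pos_of_ne_bot (hS P hP).2.1
  · exact_mod_cast h1

/-- The logarithm of the norm of an ideal in terms of the prime powers dividing it. -/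
lemma log_absNorm_le_sum [DecidableRel fun I J : Ideal (𝓞 K) => I ≤ J]
    {I : Ideal (𝓞 K)} (hI : I ≠ ⊥) {n J : ℕ} (hn : Ideal.absNorm I ≤ n)
    (hJ : n < 2 ^ J) :
    Real.log (Ideal.absNorm I) ≤ ∑ P ∈ primesUpTo K n, ∑ j ∈ Finset.Icc 1 J,
      if I ≤ P ^ j then Real.log (Ideal.absNorm P) else 0 := by
  classical
  set f := UniqueFactorizationMonoid.normalizedFactors I with hf
  have hprime : ∀ P ∈ f, P.IsPrime ∧ P ≠ ⊥ := fun P hP => by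
    have := UniqueFactorizationMonoid.prime_of_normalized_factor P hP
    exact ⟨Ideal.isPrime_of_prime this, this.ne_zero⟩
  have hprod : f.prod = I := Ideal.prod_normalizedFactors_eq_self hI
  have hprod' : ∏ P ∈ f.toFinset, P ^ f.count P = I := by
    rw [← Finset.prod_multiset_count, hprod]
  have hle : ∀ {P : Ideal (𝓞 K)} {j}, I ≤ P ^ j → Ideal.absNorm P ^ j ≤ n := by
    intro P j h
    have h1 := Nat.le_of_dvd (absNorm_pos_of_ne_bot hI)
      (map_dvd Ideal.absNorm (Ideal.dvd_iff_le.mpr h))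
    rw [map_pow] at h1
    exact h1.trans hn
  have hpow : ∀ P ∈ f, ∀ j ≤ f.count P, I ≤ P ^ j := by
    intro P hP j hj
    rw [← Ideal.dvd_iff_le]
    refine (pow_dvd_pow P hj).trans ?_
    conv_rhs => rw [← hprod']
    exact Finset.dvd_prod_of_mem (fun P => P ^ f.count P) (Multiset.mem_toFinset.mpr hP)
  have hsub : f.toFinset ⊆ primesUpTo K n := by
    intro P hP
    have hP := Multiset.mem_toFinset.mp hP
    rw [mem_primesUpTo]
    refine ⟨?_, hprime P hP⟩
    simpa using hle (hpow P hP 1 (Multiset.one_le_count_iff_mem.mpr hP))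
  calc Real.log (Ideal.absNorm I)
      = ∑ P ∈ f.toFinset, f.count P * Real.log (Ideal.absNorm P) := by
        conv_lhs => rw [← hprod']
        rw [map_prod, Nat.cast_prod, Real.log_prod]
        · refine Finset.sum_congr rfl fun P _ => ?_
          rw [map_pow, Nat.cast_pow, Real.log_pow]
        · intro P hP
          have := absNorm_pos_of_ne_bot (hprime P (Multiset.mem_toFinset.mp hP)).2
          rw [map_pow]
          positivity
    _ ≤ ∑ P ∈ f.toFinset, ∑ j ∈ Finset.Icc 1 J,
          if I ≤ P ^ j then Real.log (Ideal.absNorm P) else 0 := by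
        refine Finset.sum_le_sum fun P hP => ?_
        have hP := Multiset.mem_toFinset.mp hP
        have hcJ : f.count P ≤ J := by
          have h1 := hle (hpow P hP _ le_rfl)
          have h2 := two_le_absNorm_of_isPrime (hprime P hP).1 (hprime P hP).2
          have h3 := (Nat.pow_le_pow_left h2 (f.count P)).trans (h1.trans hJ.le)
          exact (Nat.pow_le_pow_iff_right (by norm_num)).mp h3
        rw [← Finset.sum_filter, Finset.sum_const, nsmul_eq_mul]
        refine mul_le_mul_of_nonneg_right ?_ (log_absNorm_nonneg P)
        have : Finset.Icc 1 (f.count P) ⊆ (Finset.Icc 1 J).filter fun j => I ≤ P ^ j := by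
          intro j hj
          rw [Finset.mem_Icc] at hj
          rw [Finset.mem_filter, Finset.mem_Icc]
          exact ⟨⟨hj.1, hj.2.trans hcJ⟩, hpow P hP j hj.2⟩
        have := Finset.card_le_card this
        rw [Nat.card_Icc, Nat.add_sub_cancel] at this
        exact_mod_cast this
    _ ≤ _ := by
        refine Finset.sum_le_sum_of_subset_of_nonneg hsub fun P _ _ => ?_
        refine Finset.sum_nonneg fun j _ => ?_
        split_ifs
        exacts [log_absNorm_nonneg P, le_rfl]

/-- Chebyshev's upper bound for prime ideals. -/
lemma idealTheta_le (n : ℕ) : idealTheta K n ≤ Module.finrank ℚ K * Real.log 4 * n := by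
  have h0 : Ideal.span {((primorial n : ℕ) : 𝓞 K)} ≠ ⊥ := by
    simpa using (primorial_pos n).ne'
  refine (sum_log_absNorm_le h0 _ fun P hP => ?_).trans ?_
  · rw [mem_primesUpTo] at hP
    refine ⟨hP.2.1, hP.2.2, ?_⟩
    rw [Ideal.span_singleton_le_iff_mem]
    have h2 := two_le_absNorm_of_isPrime hP.2.1 hP.2.2
    have hmem : ((∏ p ∈ (Ideal.absNorm P).primeFactorsList.toFinset,
        p ^ (Ideal.absNorm P).factorization p : ℕ) : 𝓞 K) ∈ P := by
      have h3 := Nat.prod_factorization_pow_eq_self (show Ideal.absNorm P ≠ 0 by omega)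
      have h4 := Ideal.absNorm_mem P
      rw [← h3] at h4
      exact h4
    rw [Nat.cast_prod] at hmem
    obtain ⟨p, hp, hpP⟩ := (Ideal.IsPrime.prod_mem_iff (hp := hP.2.1)).mp hmem
    rw [Nat.cast_pow] at hpP
    have hpP := hP.2.1.mem_of_pow_mem _ hpP
    have hp' := Nat.mem_primeFactorsList'.mp (List.mem_toFinset.mp hp)
    have hpn : p ≤ n := (Nat.le_of_dvd (by omega) hp'.2.1).trans hP.1
    obtain ⟨m, hm⟩ := (hp'.1.dvd_primorial_iff (n := n)).mpr hpn
    rw [hm, Nat.cast_mul]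
    exact P.mul_mem_right _ hpP
  · have h1 : (Ideal.absNorm (Ideal.span {((primorial n : ℕ) : 𝓞 K)}) : ℝ)
        ≤ ((4 : ℝ) ^ n) ^ Module.finrank ℚ K := by
      refine absNorm_span_singleton_le fun σ => ?_
      simp only [map_natCast, Complex.norm_natCast]
      exact_mod_cast primorial_le_four_pow n
    refine (Real.log_le_log (by exact_mod_cast absNorm_pos_of_ne_bot h0) h1).trans ?_
    rw [Real.log_pow, Real.log_pow]
    exact le_of_eq (by ring)

/-- Partial summation against a decreasing function. -/
lemma sum_primesUpTo_le {C : ℝ} (hC : ∀ n, idealTheta K n ≤ C * n) (f : ℕ → ℝ)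
    (hf : ∀ m, 1 ≤ m → f (m + 1) ≤ f m) (hf0 : ∀ m, 0 ≤ f m) (n : ℕ) :
    ∑ P ∈ primesUpTo K n, Real.log (Ideal.absNorm P) * f (Ideal.absNorm P)
      ≤ C * ∑ m ∈ Finset.Icc 1 n, f m := by
  have key : ∑ P ∈ primesUpTo K n, Real.log (Ideal.absNorm P) * (f (Ideal.absNorm P) - f n)
      ≤ C * (∑ m ∈ Finset.Icc 1 n, f m - n * f n) := by
    induction n with
    | zero =>
      have : primesUpTo K 0 = ∅ := by
        refine Finset.eq_empty_of_forall_notMem fun P hP => ?_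
        have h1 := two_le_absNorm_of_mem hP
        have h2 := (mem_primesUpTo.mp hP).1
        omega
      simp [this]
    | succ n ih =>
      have h1 : ∑ P ∈ primesUpTo K (n + 1),
            Real.log (Ideal.absNorm P) * (f (Ideal.absNorm P) - f (n + 1))
          = ∑ P ∈ primesUpTo K n,
            Real.log (Ideal.absNorm P) * (f (Ideal.absNorm P) - f (n + 1)) := by
        symm
        refine Finset.sum_subset (primesUpTo_mono n.le_succ) fun P hP hP' => ?_
        rw [mem_primesUpTo] at hP hP'
        have : Ideal.absNorm P = n + 1 := by
          by_contra h
          exact hP' ⟨by omega, hP.2⟩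
        rw [this, sub_self, mul_zero]
      have h2 : ∑ P ∈ primesUpTo K n,
            Real.log (Ideal.absNorm P) * (f (Ideal.absNorm P) - f (n + 1))
          = ∑ P ∈ primesUpTo K n, Real.log (Ideal.absNorm P) * (f (Ideal.absNorm P) - f n)
            + idealTheta K n * (f n - f (n + 1)) := by
        rw [idealTheta, Finset.sum_mul, ← Finset.sum_add_distrib]
        exact Finset.sum_congr rfl fun P _ => by ring
      rw [h1, h2, Finset.sum_Icc_succ_top (by omega)]
      have h3 : idealTheta K n * (f n - f (n + 1)) ≤ C * n * (f n - f (n + 1)) := by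
        rcases Nat.eq_zero_or_pos n with rfl | hn
        · have : primesUpTo K 0 = ∅ := by
            refine Finset.eq_empty_of_forall_notMem fun P hP => ?_
            have h1 := two_le_absNorm_of_mem hP
            have h2 := (mem_primesUpTo.mp hP).1
            omega
          simp [idealTheta, this]
        · exact mul_le_mul_of_nonneg_right (hC n) (sub_nonneg.mpr (hf n hn))
      push_cast
      linarith
  have h2 : ∑ P ∈ primesUpTo K n, Real.log (Ideal.absNorm P) * (f (Ideal.absNorm P) - f n)
      = ∑ P ∈ primesUpTo K n, Real.log (Ideal.absNorm P) * f (Ideal.absNorm P)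
        - idealTheta K n * f n := by
    rw [idealTheta, Finset.sum_mul, ← Finset.sum_sub_distrib]
    exact Finset.sum_congr rfl fun P _ => by ring
  have h3 := mul_le_mul_of_nonneg_right (hC n) (hf0 n)
  linarith

lemma sum_rpow_le {ε : ℝ} (h0 : 0 < ε) (h1 : ε ≤ 1) (n : ℕ) :
    ∑ m ∈ Finset.Icc 1 n, (m : ℝ) ^ (ε - 1) ≤ (n : ℝ) ^ ε / ε := by
  induction n with
  | zero => simp [Real.zero_rpow h0.ne']
  | succ n ih =>
    rw [Finset.sum_Icc_succ_top (by omega)]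
    have hn : (0 : ℝ) < (n : ℝ) + 1 := by positivity
    have hb := rpow_one_add_le_one_add_mul_self (s := -(1 / ((n : ℝ) + 1)))
      (by rw [neg_le_neg_iff, div_le_one hn]; linarith [Nat.cast_nonneg (α := ℝ) n]) h0.le h1
    have h2 : (n : ℝ) = (n + 1) * (1 + -(1 / ((n : ℝ) + 1))) := by field_simp; ring
    have h3 : (n : ℝ) ^ ε ≤ ((n : ℝ) + 1) ^ ε * (1 + ε * -(1 / ((n : ℝ) + 1))) := by
      conv_lhs => rw [h2]
      rw [Real.mul_rpow hn.le
        (by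
          have : (1 : ℝ) + -(1 / ((n : ℝ) + 1)) = n / (n + 1) := by field_simp; ring
          rw [this]
          positivity)]
      gcongr
    have h4 : ((n : ℝ) + 1) ^ (ε - 1) = ((n : ℝ) + 1) ^ ε / (n + 1) := by
      rw [Real.rpow_sub hn, Real.rpow_one]
    push_cast
    rw [h4]
    calc _ ≤ (n : ℝ) ^ ε / ε + ((n : ℝ) + 1) ^ ε / (n + 1) := by gcongr
      _ ≤ (((n : ℝ) + 1) ^ ε * (1 + ε * -(1 / ((n : ℝ) + 1)))) / ε
          + ((n : ℝ) + 1) ^ ε / (n + 1) := by gcongr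
      _ = _ := by field_simp; ring

lemma sum_inv_sq_le (n : ℕ) : ∑ m ∈ Finset.Icc 1 n, ((m : ℝ) ^ 2)⁻¹ ≤ 2 := by
  suffices h : ∑ m ∈ Finset.Icc 1 n, ((m : ℝ) ^ 2)⁻¹ ≤ 2 - 1 / n by
    have : (0 : ℝ) ≤ 1 / n := by positivity
    linarith
  induction n with
  | zero => norm_num
  | succ n ih =>
    rcases Nat.eq_zero_or_pos n with rfl | hn
    · norm_num
    rw [Finset.sum_Icc_succ_top (by omega)]
    push_cast
    have hn : (0 : ℝ) < n := by exact_mod_cast hn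
    have : (((n : ℝ) + 1) ^ 2)⁻¹ ≤ 1 / (n : ℝ) - 1 / ((n : ℝ) + 1) := by
      rw [div_sub_div _ _ (by positivity) (by positivity), inv_eq_one_div,
        div_le_div_iff₀ (by positivity) (by positivity)]
      nlinarith
    linarith

end Primes

section Mertens

open NumberField

variable (K : Type*) [Field K] [NumberField K]

/-- For every scale `y` there are weights `cnt I`, the number of points of the ideal `I` in a box
of side `y`, which satisfy two-sided bounds and compute the total logarithmic norm of the box. -/
lemma exists_box_statistics :
    ∃ C : ℕ, 1 ≤ C ∧ ∀ y : ℕ, 1 ≤ y → ∃ cnt : Ideal (𝓞 K) → ℕ,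
      (∀ I, I ≠ ⊥ → (cnt I : ℝ) * Ideal.absNorm I
        ≤ (y + C * (Ideal.absNorm I : ℝ) ^ (1 / (Module.finrank ℚ K : ℝ))) ^ Module.finrank ℚ K) ∧
      (∀ I, I ≠ ⊥ → (y : ℝ) ^ Module.finrank ℚ K *
          (1 - C * ((Ideal.absNorm I : ℝ) ^ (1 / (Module.finrank ℚ K : ℝ)) / y))
        ≤ (cnt I : ℝ) * Ideal.absNorm I) ∧
      (∀ I, cnt I ≠ 0 → Ideal.absNorm I ≤ C * y ^ Module.finrank ℚ K) ∧
      (∀ n, ∑ P ∈ primesUpTo K n, Real.log (Ideal.absNorm P) * cnt P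
        ≤ (y : ℝ) ^ Module.finrank ℚ K * Real.log (C * (y : ℝ) ^ Module.finrank ℚ K)) ∧
      (∀ J, C * y ^ Module.finrank ℚ K < 2 ^ J →
        (y : ℝ) ^ Module.finrank ℚ K * Real.log ((y : ℝ) ^ Module.finrank ℚ K)
          ≤ ∑ P ∈ primesUpTo K (C * y ^ Module.finrank ℚ K), ∑ j ∈ Finset.Icc 1 J,
            Real.log (Ideal.absNorm P) * cnt (P ^ j)) := by
  classical
  let ω := RingOfIntegers.basis K
  have hcard : Fintype.card (Module.Free.ChooseBasisIndex ℤ (𝓞 K)) = Module.finrank ℚ K := by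
    rw [← RingOfIntegers.rank, Module.finrank_eq_card_chooseBasisIndex]
  set D := Module.finrank ℚ K with hD
  have : Nonempty (Module.Free.ChooseBasisIndex ℤ (𝓞 K)) := by
    rw [← Fintype.card_pos_iff, hcard]
    exact Module.finrank_pos
  obtain ⟨C₁, hC₁, hcount⟩ := exists_boxCount_bounds ω
  obtain ⟨k, C₂, hC₂, hnorm⟩ := exists_shift_norm_bounds ω
  rw [← hD] at hnorm
  simp only [hcard] at hcount
  obtain ⟨C, hC⟩ := exists_nat_ge (max C₁ C₂)
  have hCC₁ : C₁ ≤ C := (le_max_left _ _).trans hC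
  have hCC₂ : C₂ ≤ C := (le_max_right _ _).trans hC
  refine ⟨C, by exact_mod_cast hC₁.trans hCC₁, fun y hy => ?_⟩
  set c : 𝓞 K := ((k * y : ℕ) : 𝓞 K) with hc
  set Bx := Fintype.piFinset fun _ : Module.Free.ChooseBasisIndex ℤ (𝓞 K) =>
    Finset.Ico (0 : ℤ) y with hBx
  have hBcard : (Bx.card : ℝ) = (y : ℝ) ^ D := by
    rw [hBx]
    simp [Fintype.card_piFinset, hcard]
  let z : (Module.Free.ChooseBasisIndex ℤ (𝓞 K) → ℤ) → 𝓞 K := fun a => c + ω.equivFun.symm a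
  have hcnt : ∀ I, boxCount ω c y I = (Bx.filter fun a => z a ∈ I).card := fun I => by
    rw [boxCount]
  have hy0 : (0 : ℝ) < y := by exact_mod_cast hy
  have hz : ∀ a ∈ Bx, (y : ℝ) ^ D ≤ Ideal.absNorm (Ideal.span {z a}) ∧
      (Ideal.absNorm (Ideal.span {z a}) : ℝ) ≤ C * (y : ℝ) ^ D := by
    intro a ha
    have h := hnorm y a fun i => by simpa using Fintype.mem_piFinset.mp ha i
    exact ⟨h.1, h.2.trans (by gcongr)⟩
  have hz0 : ∀ a ∈ Bx, Ideal.span {z a} ≠ ⊥ := by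
    intro a ha h
    have h1 := (hz a ha).1
    rw [h, Ideal.absNorm_bot, Nat.cast_zero] at h1
    have : 0 < (y : ℝ) ^ D := by positivity
    linarith
  have hz2 : ∀ a ∈ Bx, Ideal.absNorm (Ideal.span {z a}) ≤ C * y ^ D := fun a ha => by
    exact_mod_cast (hz a ha).2
  refine ⟨boxCount ω c y, fun I hI => ?_, fun I hI => ?_, fun I hI => ?_, fun n => ?_,
    fun J hJ => ?_⟩
  · refine (hcount c y hy I hI).1.trans ?_
    gcongr
  · refine le_trans ?_ (hcount c y hy I hI).2
    gcongr
  · rw [hcnt, Finset.card_ne_zero] at hI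
    obtain ⟨a, ha⟩ := hI
    rw [Finset.mem_filter] at ha
    refine le_trans ?_ (hz2 a ha.1)
    exact Nat.le_of_dvd (absNorm_pos_of_ne_bot (hz0 a ha.1))
      (map_dvd Ideal.absNorm (Ideal.dvd_iff_le.mpr (by
        rw [Ideal.span_singleton_le_iff_mem]; exact ha.2)))
  · calc ∑ P ∈ primesUpTo K n, Real.log (Ideal.absNorm P) * (boxCount ω c y P : ℝ)
        = ∑ a ∈ Bx, ∑ P ∈ (primesUpTo K n).filter (fun P => z a ∈ P),
            Real.log (Ideal.absNorm P) := by
          simp only [Finset.sum_filter]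
          rw [Finset.sum_comm]
          refine Finset.sum_congr rfl fun P _ => ?_
          rw [← Finset.sum_filter, Finset.sum_const, nsmul_eq_mul, hcnt, mul_comm]
      _ ≤ ∑ a ∈ Bx, Real.log (Ideal.absNorm (Ideal.span {z a})) := by
          refine Finset.sum_le_sum fun a ha => sum_log_absNorm_le (hz0 a ha) _ fun P hP => ?_
          rw [Finset.mem_filter, mem_primesUpTo] at hP
          rw [Ideal.span_singleton_le_iff_mem]
          exact ⟨hP.1.2.1, hP.1.2.2, hP.2⟩
      _ ≤ ∑ a ∈ Bx, Real.log (C * (y : ℝ) ^ D) := by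
          refine Finset.sum_le_sum fun a ha => Real.log_le_log ?_ (hz a ha).2
          exact_mod_cast absNorm_pos_of_ne_bot (hz0 a ha)
      _ = _ := by rw [Finset.sum_const, nsmul_eq_mul, hBcard]
  · calc (y : ℝ) ^ D * Real.log ((y : ℝ) ^ D)
        = ∑ a ∈ Bx, Real.log ((y : ℝ) ^ D) := by rw [Finset.sum_const, nsmul_eq_mul, hBcard]
      _ ≤ ∑ a ∈ Bx, Real.log (Ideal.absNorm (Ideal.span {z a})) :=
          Finset.sum_le_sum fun a ha => Real.log_le_log (by positivity) (hz a ha).1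
      _ ≤ ∑ a ∈ Bx, ∑ P ∈ primesUpTo K (C * y ^ D), ∑ j ∈ Finset.Icc 1 J,
            if Ideal.span {z a} ≤ P ^ j then Real.log (Ideal.absNorm P) else 0 :=
          Finset.sum_le_sum fun a ha => log_absNorm_le_sum (hz0 a ha) (hz2 a ha) hJ
      _ = _ := by
          rw [Finset.sum_comm]
          refine Finset.sum_congr rfl fun P _ => ?_
          rw [Finset.sum_comm]
          refine Finset.sum_congr rfl fun j _ => ?_
          simp only [Ideal.span_singleton_le_iff_mem]
          rw [← Finset.sum_filter, Finset.sum_const, nsmul_eq_mul, hcnt, mul_comm]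

lemma exists_idealTheta_le : ∃ C : ℝ, 0 ≤ C ∧ ∀ n, idealTheta K n ≤ C * n :=
  ⟨_, mul_nonneg (Nat.cast_nonneg _) (Real.log_nonneg (by norm_num)), idealTheta_le⟩

lemma sum_log_mul_rpow_le {C : ℝ} (hC0 : 0 ≤ C) (hC : ∀ n, idealTheta K n ≤ C * n) (n : ℕ) :
    ∑ P ∈ primesUpTo K n, Real.log (Ideal.absNorm P) *
        (Ideal.absNorm P : ℝ) ^ (1 / (Module.finrank ℚ K : ℝ) - 1)
      ≤ C * Module.finrank ℚ K * (n : ℝ) ^ (1 / (Module.finrank ℚ K : ℝ)) := by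
  set D := Module.finrank ℚ K with hD
  have hD1 : (1 : ℝ) ≤ D := by exact_mod_cast (Module.finrank_pos : 0 < Module.finrank ℚ K)
  have hε : 1 / (D : ℝ) ≤ 1 := by rw [div_le_one (by positivity)]; exact hD1
  refine (sum_primesUpTo_le hC (fun m => (m : ℝ) ^ (1 / (D : ℝ) - 1)) (fun m hm => ?_)
    (fun m => by positivity) n).trans ?_
  · exact Real.rpow_le_rpow_of_nonpos (by exact_mod_cast hm) (by push_cast; linarith)
      (by linarith)
  · rw [mul_assoc]
    gcongr
    refine (sum_rpow_le (by positivity) hε n).trans (le_of_eq ?_)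
    field_simp

lemma sum_log_div_sq_le {C : ℝ} (hC0 : 0 ≤ C) (hC : ∀ n, idealTheta K n ≤ C * n) (n : ℕ) :
    ∑ P ∈ primesUpTo K n, Real.log (Ideal.absNorm P) * ((Ideal.absNorm P : ℝ) ^ 2)⁻¹
      ≤ C * 2 := by
  refine (sum_primesUpTo_le hC (fun m => ((m : ℝ) ^ 2)⁻¹) (fun m hm => ?_)
    (fun m => by positivity) n).trans ?_
  · have : (0 : ℝ) < m := by exact_mod_cast hm
    push_cast
    gcongr
    linarith
  · gcongr
    exact sum_inv_sq_le n

lemma exists_pow_between {D : ℕ} (hD : 0 < D) {n : ℕ} (hn : 1 ≤ n) :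
    ∃ y : ℕ, 1 ≤ y ∧ n ≤ y ^ D ∧ y ^ D ≤ 2 ^ D * n := by
  have hex : ∃ y : ℕ, n ≤ y ^ D := ⟨n, Nat.le_self_pow hD.ne' n⟩
  classical
  have h1 := Nat.find_spec hex
  have hpos : 1 ≤ Nat.find hex := by
    by_contra h
    have : Nat.find hex = 0 := by omega
    rw [this, zero_pow hD.ne'] at h1
    omega
  refine ⟨Nat.find hex, hpos, h1, ?_⟩
  rcases hpos.eq_or_lt with h | h
  · rw [← h, one_pow]
    exact Nat.mul_pos (by positivity) hn
  · have h2 := Nat.find_min hex (m := Nat.find hex - 1) (by omega)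
    push Not at h2
    calc Nat.find hex ^ D ≤ (2 * (Nat.find hex - 1)) ^ D := Nat.pow_le_pow_left (by omega) D
      _ = 2 ^ D * (Nat.find hex - 1) ^ D := mul_pow _ _ _
      _ ≤ 2 ^ D * n := Nat.mul_le_mul_left _ h2.le

lemma rpow_one_div_le {D : ℕ} (hD : 0 < D) {a y : ℝ} (ha : 0 ≤ a) (hy : 0 ≤ y) (h : a ≤ y ^ D) :
    a ^ (1 / (D : ℝ)) ≤ y := by
  calc a ^ (1 / (D : ℝ)) ≤ (y ^ D) ^ (1 / (D : ℝ)) := by gcongr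
    _ = y := by rw [one_div, Real.pow_rpow_inv_natCast hy hD.ne']

/-- The upper half of Mertens' theorem for prime ideals. -/
lemma exists_mertens_upper : ∃ A : ℝ, ∀ n : ℕ, 1 ≤ n →
    ∑ P ∈ primesUpTo K n, Real.log (Ideal.absNorm P) / Ideal.absNorm P ≤ Real.log n + A := by
  obtain ⟨C, hC, hbox⟩ := exists_box_statistics K
  obtain ⟨Cθ, hCθ0, hCθ⟩ := exists_idealTheta_le K
  have hsum := sum_log_mul_rpow_le K hCθ0 hCθ
  set D := Module.finrank ℚ K with hD
  have hD0 : 0 < D := Module.finrank_pos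
  refine ⟨Real.log (C * 2 ^ D) + C * (Cθ * D), fun n hn => ?_⟩
  obtain ⟨y, hy, hny, hyn⟩ := exists_pow_between hD0 hn
  obtain ⟨cnt, -, hlow, -, hub, -⟩ := hbox y hy
  have hy0 : (0 : ℝ) < y := by exact_mod_cast hy
  have hn0 : (0 : ℝ) < n := by exact_mod_cast hn
  have hC0 : (0 : ℝ) < C := by exact_mod_cast hC
  set x : ℝ := (y : ℝ) ^ D with hx
  have hx0 : 0 < x := by positivity
  have hnx : (n : ℝ) ≤ x := by rw [hx]; exact_mod_cast hny
  have hxn : x ≤ 2 ^ D * n := by rw [hx]; exact_mod_cast hyn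
  have h1 : x * (∑ P ∈ primesUpTo K n, Real.log (Ideal.absNorm P) / Ideal.absNorm P)
      - x * (C / y) * ∑ P ∈ primesUpTo K n, Real.log (Ideal.absNorm P) *
        (Ideal.absNorm P : ℝ) ^ (1 / (D : ℝ) - 1) ≤ x * Real.log (C * x) := by
    refine le_trans ?_ (hub n)
    rw [Finset.mul_sum, Finset.mul_sum, ← Finset.sum_sub_distrib]
    refine Finset.sum_le_sum fun P hP => ?_
    have hq : (0 : ℝ) < Ideal.absNorm P := by
      have := two_le_absNorm_of_mem hP
      positivity
    have h2 := hlow P (mem_primesUpTo.mp hP).2.2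
    rw [Real.rpow_sub hq, Real.rpow_one]
    have h3 : (y : ℝ) ^ D * (1 - C * ((Ideal.absNorm P : ℝ) ^ (1 / (D : ℝ)) / y))
        / Ideal.absNorm P ≤ cnt P := by
      rw [div_le_iff₀ hq]
      exact h2
    have h4 := mul_le_mul_of_nonneg_left h3 (log_absNorm_nonneg P)
    refine le_trans (le_of_eq ?_) h4
    rw [← hx]
    ring
  have h2 : ∑ P ∈ primesUpTo K n, Real.log (Ideal.absNorm P) *
      (Ideal.absNorm P : ℝ) ^ (1 / (D : ℝ) - 1) ≤ Cθ * D * y := by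
    refine (hsum n).trans ?_
    gcongr
    exact rpow_one_div_le hD0 hn0.le hy0.le hnx
  have h3 : x * (C / y) * ∑ P ∈ primesUpTo K n, Real.log (Ideal.absNorm P) *
      (Ideal.absNorm P : ℝ) ^ (1 / (D : ℝ) - 1) ≤ x * (C * (Cθ * D)) := by
    calc _ ≤ x * (C / y) * (Cθ * D * y) := by gcongr
      _ = _ := by field_simp
  have h4 : Real.log (C * x) ≤ Real.log n + Real.log (C * 2 ^ D) := by
    rw [← Real.log_mul (by positivity) (by positivity)]
    apply Real.log_le_log (by positivity)
    calc C * x ≤ C * (2 ^ D * n) := by gcongr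
      _ = _ := by ring
  have h5 : x * (∑ P ∈ primesUpTo K n, Real.log (Ideal.absNorm P) / Ideal.absNorm P)
      ≤ x * (Real.log n + (Real.log (C * 2 ^ D) + C * (Cθ * D))) := by
    have := mul_le_mul_of_nonneg_left h4 hx0.le
    linarith
  exact le_of_mul_le_mul_left h5 hx0

end Mertens

section Chebyshev

open NumberField

variable (K : Type*) [Field K] [NumberField K]

lemma one_add_mul_pow_le {C v : ℝ} (hC : 0 ≤ C) (hv0 : 0 ≤ v) (hv1 : v ≤ 1) (D : ℕ) :
    (1 + C * v) ^ D ≤ 1 + (1 + C) ^ D * v := by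
  suffices h : (1 + C * v) ^ D ≤ 1 + ((1 + C) ^ D - 1) * v by nlinarith
  induction D with
  | zero => simp
  | succ D ih =>
    have h1 : 1 ≤ (1 + C) ^ D := one_le_pow₀ (by linarith)
    calc (1 + C * v) ^ (D + 1) ≤ (1 + ((1 + C) ^ D - 1) * v) * (1 + C * v) := by
          rw [pow_succ]
          gcongr
      _ ≤ _ := by
          rw [pow_succ]
          have h2 : v * v ≤ v := mul_le_of_le_one_right hv0 hv1
          have h3 : 0 ≤ C * ((1 + C) ^ D - 1) := mul_nonneg hC (by linarith)
          nlinarith [mul_le_mul_of_nonneg_left h2 h3]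

lemma sum_Icc_two_inv_pow_le {q : ℝ} (hq : 2 ≤ q) (J : ℕ) :
    ∑ j ∈ Finset.Icc 2 J, (q ^ j)⁻¹ ≤ 2 * (q ^ 2)⁻¹ := by
  suffices h : ∑ j ∈ Finset.Icc 2 J, (q ^ j)⁻¹ ≤ 2 * (q ^ 2)⁻¹ - (q ^ J)⁻¹ ∨ J < 2 by
    rcases h with h | h
    · have : 0 ≤ (q ^ J)⁻¹ := by positivity
      linarith
    · rw [Finset.Icc_eq_empty (by omega), Finset.sum_empty]
      positivity
  induction J with
  | zero => exact Or.inr (by norm_num)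
  | succ J ih =>
    rcases ih with ih | ih
    · left
      rcases lt_or_ge J 1 with hJ | hJ
      · have hJ0 : J = 0 := by omega
        subst hJ0
        simp at ih ⊢
        have h1 : (q ^ 2)⁻¹ ≤ 1 / 4 := by
          rw [inv_eq_one_div, one_div_le_one_div (by positivity) (by norm_num)]
          nlinarith
        linarith
      · rw [Finset.sum_Icc_succ_top (by omega)]
        have h1 : (q ^ (J + 1))⁻¹ ≤ (q ^ J)⁻¹ * (1 / 2) := by
          rw [pow_succ, mul_inv]
          gcongr
          rw [inv_eq_one_div]
          exact one_div_le_one_div_of_le (by norm_num) hq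
        linarith
    · rcases Nat.lt_or_ge (J + 1) 2 with hJ | hJ
      · exact Or.inr hJ
      · left
        have : J + 1 = 2 := by omega
        rw [this, Finset.Icc_self, Finset.sum_singleton]
        linarith

/-- A form of the lower half of Mertens' theorem: the primes of norm at most `m` account for
`log m` and those beyond for a multiple of `θ / m`. -/
lemma exists_log_le_log_add_idealTheta : ∃ (C : ℕ) (A : ℝ), 1 ≤ C ∧ 0 < A ∧
    ∀ y m : ℕ, 1 ≤ y → 1 ≤ m → m ≤ y ^ Module.finrank ℚ K →
      Real.log ((y : ℝ) ^ Module.finrank ℚ K)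
        ≤ Real.log m + A + A / m * idealTheta K (C * y ^ Module.finrank ℚ K) := by
  obtain ⟨C, hC, hbox⟩ := exists_box_statistics K
  obtain ⟨Cθ, hCθ0, hCθ⟩ := exists_idealTheta_le K
  obtain ⟨CM, hCM⟩ := exists_mertens_upper K
  have hsum := sum_log_mul_rpow_le K hCθ0 hCθ
  have hsq := sum_log_div_sq_le K hCθ0 hCθ
  set D := Module.finrank ℚ K with hD
  have hD0 : 0 < D := Module.finrank_pos
  have hC0 : (1 : ℝ) ≤ C := by exact_mod_cast hC
  set E : ℝ := (1 + C) ^ D with hE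
  set E' : ℝ := (1 + C * C) ^ D with hE'
  have hE0 : 0 < E := by positivity
  have hE'0 : 0 < E' := by positivity
  refine ⟨C, |CM| + E * (Cθ * D) + E' + 2 * E' * (Cθ * 2), hC, by positivity,
    fun y m hy hm hmy => ?_⟩
  obtain ⟨cnt, hup, -, hne, -, hlo⟩ := hbox y hy
  have hy0 : (0 : ℝ) < y := by exact_mod_cast hy
  have hm0 : (0 : ℝ) < m := by exact_mod_cast hm
  set N := C * y ^ D with hN
  set x : ℝ := (y : ℝ) ^ D with hx
  have hx0 : 0 < x := by positivity
  have hmx : (m : ℝ) ≤ x := by rw [hx]; exact_mod_cast hmy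
  have hmN : m ≤ N := hmy.trans (Nat.le_mul_of_pos_left _ hC)
  -- the two upper bounds for the counts
  have hcnt : ∀ I : Ideal (𝓞 K), I ≠ ⊥ → (cnt I : ℝ) ≤ E' * x * (Ideal.absNorm I : ℝ)⁻¹ := by
    intro I hI
    have hq : (0 : ℝ) < Ideal.absNorm I := by exact_mod_cast absNorm_pos_of_ne_bot hI
    rcases eq_or_ne (cnt I) 0 with h0 | h0
    · rw [h0, Nat.cast_zero]
      positivity
    · rw [← div_eq_mul_inv, le_div_iff₀ hq]
      refine (hup I hI).trans ?_
      have hu : (Ideal.absNorm I : ℝ) ^ (1 / (D : ℝ)) ≤ C * y := by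
        refine rpow_one_div_le hD0 hq.le (by positivity) ?_
        calc (Ideal.absNorm I : ℝ) ≤ C * (y : ℝ) ^ D := by exact_mod_cast hne I h0
          _ ≤ (C : ℝ) ^ D * (y : ℝ) ^ D := by
            gcongr
            exact le_self_pow₀ hC0 hD0.ne'
          _ = _ := (mul_pow _ _ _).symm
      rw [hE', hx, ← mul_pow]
      gcongr
      nlinarith
  have hcnt' : ∀ P ∈ primesUpTo K m, (cnt P : ℝ) ≤ x * (Ideal.absNorm P : ℝ)⁻¹ +
      x * E / y * (Ideal.absNorm P : ℝ) ^ (1 / (D : ℝ) - 1) := by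
    intro P hP
    have hP' := mem_primesUpTo.mp hP
    have hq : (0 : ℝ) < Ideal.absNorm P := by exact_mod_cast absNorm_pos_of_ne_bot hP'.2.2
    set u := (Ideal.absNorm P : ℝ) ^ (1 / (D : ℝ)) with hu
    have huy : u ≤ y := rpow_one_div_le hD0 hq.le hy0.le
      (le_trans (by exact_mod_cast hP'.1) hmx)
    rw [Real.rpow_sub hq, Real.rpow_one, ← hu]
    have h1 : (cnt P : ℝ) * Ideal.absNorm P ≤ x * (1 + E * (u / y)) := by
      calc (cnt P : ℝ) * Ideal.absNorm P ≤ (y + C * u) ^ D := hup P hP'.2.2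
        _ = x * (1 + C * (u / y)) ^ D := by
          rw [hx, ← mul_pow]
          congr 1
          field_simp
        _ ≤ x * (1 + E * (u / y)) := by
          gcongr
          exact one_add_mul_pow_le (by linarith) (by positivity) ((div_le_one hy0).mpr huy) D
    rw [← le_div_iff₀ hq] at h1
    exact h1.trans (le_of_eq (by ring))
  have hsmall : ∑ P ∈ primesUpTo K m, Real.log (Ideal.absNorm P) * (cnt P : ℝ)
      ≤ x * (Real.log m + |CM| + E * (Cθ * D)) := by
    calc _ ≤ ∑ P ∈ primesUpTo K m, Real.log (Ideal.absNorm P) *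
          (x * (Ideal.absNorm P : ℝ)⁻¹ +
            x * E / y * (Ideal.absNorm P : ℝ) ^ (1 / (D : ℝ) - 1)) :=
          Finset.sum_le_sum fun P hP =>
            mul_le_mul_of_nonneg_left (hcnt' P hP) (log_absNorm_nonneg P)
      _ = x * (∑ P ∈ primesUpTo K m, Real.log (Ideal.absNorm P) / Ideal.absNorm P) +
          x * E / y * ∑ P ∈ primesUpTo K m, Real.log (Ideal.absNorm P) *
            (Ideal.absNorm P : ℝ) ^ (1 / (D : ℝ) - 1) := by
          rw [Finset.mul_sum, Finset.mul_sum, ← Finset.sum_add_distrib]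
          exact Finset.sum_congr rfl fun P _ => by ring
      _ ≤ x * (Real.log m + |CM|) + x * E / y * (Cθ * D * y) := by
          gcongr
          · exact (hCM m hm).trans (by linarith [le_abs_self CM])
          · refine (hsum m).trans ?_
            gcongr
            exact rpow_one_div_le hD0 hm0.le hy0.le hmx
      _ = _ := by
          field_simp
  have hlarge : ∑ P ∈ primesUpTo K N \ primesUpTo K m, Real.log (Ideal.absNorm P) * (cnt P : ℝ)
      ≤ x * (E' / m * idealTheta K N) := by
    calc _ ≤ ∑ P ∈ primesUpTo K N \ primesUpTo K m, Real.log (Ideal.absNorm P) * (E' * x / m) := by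
          refine Finset.sum_le_sum fun P hP => ?_
          rw [Finset.mem_sdiff, mem_primesUpTo, mem_primesUpTo] at hP
          refine mul_le_mul_of_nonneg_left ((hcnt P hP.1.2.2).trans ?_) (log_absNorm_nonneg P)
          have h1 : (m : ℝ) ≤ Ideal.absNorm P := by
            have : m ≤ Ideal.absNorm P := by
              by_contra h
              exact hP.2 ⟨by omega, hP.1.2⟩
            exact_mod_cast this
          rw [div_eq_mul_inv]
          gcongr
      _ ≤ ∑ P ∈ primesUpTo K N, Real.log (Ideal.absNorm P) * (E' * x / m) :=
          Finset.sum_le_sum_of_subset_of_nonneg Finset.sdiff_subset fun P _ _ =>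
            mul_nonneg (log_absNorm_nonneg P) (by positivity)
      _ = _ := by
          rw [← Finset.sum_mul, idealTheta]
          ring
  have hpow : ∀ J, ∑ P ∈ primesUpTo K N, ∑ j ∈ Finset.Icc 2 J,
      Real.log (Ideal.absNorm P) * (cnt (P ^ j) : ℝ) ≤ x * (2 * E' * (Cθ * 2)) := by
    intro J
    calc _ ≤ ∑ P ∈ primesUpTo K N, x * (2 * E') *
          (Real.log (Ideal.absNorm P) * ((Ideal.absNorm P : ℝ) ^ 2)⁻¹) := by
          refine Finset.sum_le_sum fun P hP => ?_
          have h2 : (2 : ℝ) ≤ Ideal.absNorm P := by exact_mod_cast two_le_absNorm_of_mem hP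
          calc _ ≤ ∑ j ∈ Finset.Icc 2 J, Real.log (Ideal.absNorm P) *
                (E' * x * ((Ideal.absNorm P : ℝ) ^ j)⁻¹) := by
                refine Finset.sum_le_sum fun j _ =>
                  mul_le_mul_of_nonneg_left ?_ (log_absNorm_nonneg P)
                have := hcnt (P ^ j) (pow_ne_zero j (mem_primesUpTo.mp hP).2.2)
                rwa [map_pow, Nat.cast_pow] at this
            _ = Real.log (Ideal.absNorm P) * (E' * x *
                ∑ j ∈ Finset.Icc 2 J, ((Ideal.absNorm P : ℝ) ^ j)⁻¹) := by
                rw [Finset.mul_sum, Finset.mul_sum]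
            _ ≤ Real.log (Ideal.absNorm P) * (E' * x * (2 * ((Ideal.absNorm P : ℝ) ^ 2)⁻¹)) := by
                refine mul_le_mul_of_nonneg_left ?_ (log_absNorm_nonneg P)
                gcongr
                exact sum_Icc_two_inv_pow_le h2 J
            _ = _ := by ring
      _ ≤ _ := by
          rw [← Finset.mul_sum]
          calc _ ≤ x * (2 * E') * (Cθ * 2) := by
                gcongr
                exact hsq N
            _ = _ := by ring
  have hNJ : N < 2 ^ (N + 1) := Nat.lt_two_pow_self.trans (Nat.pow_lt_pow_right (by norm_num) (by omega))
  have hfin := hlo (N + 1) hNJ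
  have hsplit : ∑ P ∈ primesUpTo K N, ∑ j ∈ Finset.Icc 1 (N + 1),
        Real.log (Ideal.absNorm P) * (cnt (P ^ j) : ℝ)
      = ∑ P ∈ primesUpTo K m, Real.log (Ideal.absNorm P) * (cnt P : ℝ)
        + ∑ P ∈ primesUpTo K N \ primesUpTo K m, Real.log (Ideal.absNorm P) * (cnt P : ℝ)
        + ∑ P ∈ primesUpTo K N, ∑ j ∈ Finset.Icc 2 (N + 1),
          Real.log (Ideal.absNorm P) * (cnt (P ^ j) : ℝ) := by
    rw [add_comm (∑ P ∈ primesUpTo K m, _), Finset.sum_sdiff (primesUpTo_mono hmN),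
      ← Finset.sum_add_distrib]
    refine Finset.sum_congr rfl fun P _ => ?_
    rw [← Finset.add_sum_Ioc_eq_sum_Icc (by omega : 1 ≤ N + 1), pow_one]
    rfl
  rw [hsplit] at hfin
  have hθ : 0 ≤ idealTheta K N := Finset.sum_nonneg fun P _ => log_absNorm_nonneg P
  have h1 : x * Real.log x ≤ x * (Real.log m + |CM| + E * (Cθ * D) + E' / m * idealTheta K N
      + 2 * E' * (Cθ * 2)) := by
    have := hpow (N + 1)
    linarith
  refine (le_of_mul_le_mul_left h1 hx0).trans ?_
  have h2 : E' / m * idealTheta K N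
      ≤ (|CM| + E * (Cθ * D) + E' + 2 * E' * (Cθ * 2)) / m * idealTheta K N := by
    gcongr
    have : 0 ≤ |CM| + E * (Cθ * D) + 2 * E' * (Cθ * 2) := by positivity
    linarith
  linarith

/-- Chebyshev's lower bound for prime ideals. -/
theorem exists_le_idealTheta : ∃ (c : ℝ) (n₀ : ℕ), 0 < c ∧
    ∀ n : ℕ, n₀ ≤ n → c * n ≤ idealTheta K n := by
  obtain ⟨C, A, hC, hA, h⟩ := exists_log_le_log_add_idealTheta K
  set D := Module.finrank ℚ K with hD
  have hD0 : 0 < D := Module.finrank_pos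
  obtain ⟨r, hr⟩ := exists_nat_ge (Real.exp (A + 1))
  have hr0 : (0 : ℝ) < r := (Real.exp_pos _).trans_le hr
  have hr1 : 1 ≤ r := by exact_mod_cast hr0
  have hlogr : A + 1 ≤ Real.log r := (Real.le_log_iff_exp_le hr0).mpr hr
  have hC0 : (0 : ℝ) < C := by exact_mod_cast hC
  refine ⟨1 / (A * (2 * r) * (C * 2 ^ D)), C * 2 ^ D * r, by positivity, fun n hn => ?_⟩
  -- a scale `y` with `C * y ^ D ≤ n < C * 2 ^ D * y ^ D`
  have hex : ∃ y : ℕ, n < C * (y + 1) ^ D := ⟨n, by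
    calc n < n + 1 := n.lt_succ_self
      _ ≤ (n + 1) ^ D := Nat.le_self_pow hD0.ne' _
      _ ≤ C * (n + 1) ^ D := Nat.le_mul_of_pos_left _ hC⟩
  classical
  obtain ⟨y, hy, hmin⟩ : ∃ y : ℕ, n < C * (y + 1) ^ D ∧ ∀ z < y, C * (z + 1) ^ D ≤ n :=
    ⟨Nat.find hex, Nat.find_spec hex, fun z hz => by
      have := Nat.find_min hex hz
      omega⟩
  have hCn : C * 2 ^ D ≤ n := (Nat.le_mul_of_pos_right _ hr1).trans hn
  have hy1 : 1 ≤ y := by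
    by_contra h0
    have : y = 0 := by omega
    subst this
    rw [zero_add, one_pow, mul_one] at hy
    have := Nat.le_mul_of_pos_right C (show 0 < 2 ^ D by positivity)
    omega
  have hyn : C * y ^ D ≤ n := by
    have := hmin (y - 1) (by omega)
    rwa [Nat.sub_add_cancel hy1] at this
  have hny : n ≤ C * 2 ^ D * y ^ D := by
    refine hy.le.trans ?_
    rw [mul_assoc, ← mul_pow]
    exact Nat.mul_le_mul_left _ (Nat.pow_le_pow_left (by omega) D)
  have hrx : r ≤ y ^ D := by
    have := hn.trans hny
    exact Nat.le_of_mul_le_mul_left this (by positivity)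
  set m := y ^ D / r with hm
  have hm1 : 1 ≤ m := (Nat.one_le_div_iff hr1).mpr hrx
  have hm0 : (0 : ℝ) < m := by exact_mod_cast hm1
  have hmr : (m : ℝ) * r ≤ (y : ℝ) ^ D := by exact_mod_cast Nat.div_mul_le_self (y ^ D) r
  have hmr' : (y : ℝ) ^ D ≤ 2 * r * m := by
    have h1 : y ^ D < r * (m + 1) := by
      exact Nat.lt_mul_div_succ _ hr1
    have h2 : (y : ℝ) ^ D < r * (m + 1) := by exact_mod_cast h1
    have h3 : (1 : ℝ) ≤ m := by exact_mod_cast hm1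
    nlinarith
  have hkey := h y m hy1 hm1 (Nat.div_le_self _ _)
  have hlog : Real.log m + Real.log r ≤ Real.log ((y : ℝ) ^ D) := by
    rw [← Real.log_mul hm0.ne' hr0.ne']
    exact Real.log_le_log (by positivity) hmr
  have h1 : 1 ≤ A / m * idealTheta K (C * y ^ D) := by linarith
  have hmono : idealTheta K (C * y ^ D) ≤ idealTheta K n :=
    Finset.sum_le_sum_of_subset_of_nonneg (primesUpTo_mono hyn) fun P _ _ => log_absNorm_nonneg P
  have h2 : (m : ℝ) / A ≤ idealTheta K n := by
    refine le_trans ?_ hmono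
    rw [div_le_iff₀ hA]
    rw [div_mul_eq_mul_div, le_div_iff₀ hm0] at h1
    linarith
  refine le_trans ?_ h2
  rw [one_div, inv_mul_le_iff₀ (by positivity)]
  have hny' : (n : ℝ) ≤ C * 2 ^ D * (y : ℝ) ^ D := by exact_mod_cast hny
  calc (n : ℝ) ≤ C * 2 ^ D * (y : ℝ) ^ D := hny'
    _ ≤ C * 2 ^ D * (2 * r * m) := by gcongr
    _ = _ := by field_simp

end Chebyshev

section SpecialLinear

open Matrix

/-- Crude bound on the order of `SL_n` over a finite field. -/
theorem card_specialLinearGroup_le {n : ℕ} (hn : 1 ≤ n) (F : Type*) [Field F] [Finite F] :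
    Nat.card (SpecialLinearGroup (Fin n) F) ≤ 2 * Nat.card F ^ (n ^ 2 - 1) := by
  classical
  have := Fintype.ofFinite F
  let i : Fin n := ⟨0, hn⟩
  let D : Fˣ → Matrix (Fin n) (Fin n) F := fun u => diagonal (Function.update 1 i (u : F))
  have hD : ∀ u, (D u).det = u := fun u => by
    simp [D, det_diagonal, Finset.prod_update_of_mem]
  let f : SpecialLinearGroup (Fin n) F × Fˣ → Matrix (Fin n) (Fin n) F := fun x => D x.2 * x.1.1
  have hf : Function.Injective f := by
    rintro ⟨A, u⟩ ⟨B, v⟩ h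
    have h' : D u * A.1 = D v * B.1 := h
    have huv : u = v := by
      have := congrArg det h'
      simpa [det_mul, hD, Units.ext_iff] using this
    subst huv
    have hu : IsUnit (D u) := by
      rw [isUnit_iff_isUnit_det, hD]
      exact u.isUnit
    rw [Prod.mk.injEq]
    exact ⟨Subtype.ext (hu.mul_left_cancel h'), rfl⟩
  have hcard := Nat.card_le_card_of_injective f hf
  have hq : 2 ≤ Nat.card F := Finite.one_lt_card
  have hM : Nat.card (Matrix (Fin n) (Fin n) F) = Nat.card F ^ (n ^ 2) := by
    simp [Matrix, pow_mul, sq, Nat.card_eq_fintype_card]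
  rw [Nat.card_prod, hM, Nat.card_units] at hcard
  have hn2 : n ^ 2 = (n ^ 2 - 1) + 1 := by
    have : 0 < n ^ 2 := by positivity
    omega
  rw [hn2, pow_succ] at hcard
  set q := Nat.card F
  set s := Nat.card (SpecialLinearGroup (Fin n) F)
  obtain ⟨r, hr⟩ : ∃ r, q = r + 1 := ⟨q - 1, by omega⟩
  have h1 : q ≤ 2 * (q - 1) := by omega
  have h2 : s * (q - 1) ≤ (2 * q ^ (n ^ 2 - 1)) * (q - 1) := by
    calc _ ≤ _ := hcard
      _ ≤ q ^ (n ^ 2 - 1) * (2 * (q - 1)) := by gcongr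
      _ = _ := by ring
  exact Nat.le_of_mul_le_mul_right h2 (by omega)

/-- A representation whose generators have entries in a subring lifts to that subring. -/
theorem exists_lift_specialLinearGroup {n : ℕ} {G R S : Type*} [Group G] [CommRing R] [CommRing S]
    (i : R →+* S) (hi : Function.Injective i) (Φ : G →* SpecialLinearGroup (Fin n) S)
    (Y : Set G) (hY : Subgroup.closure Y = ⊤)
    (h : ∀ y ∈ Y, ∀ a b, (Φ y : Matrix (Fin n) (Fin n) S) a b ∈ i.range) :
    ∃ Ψ : G →* SpecialLinearGroup (Fin n) R, ∀ g, SpecialLinearGroup.map i (Ψ g) = Φ g := by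
  let ι : SpecialLinearGroup (Fin n) R →* SpecialLinearGroup (Fin n) S := SpecialLinearGroup.map i
  have hι : Function.Injective ι := by
    intro A B hAB
    ext a b
    have := congrArg (fun M : SpecialLinearGroup (Fin n) S => (M : Matrix _ _ S) a b) hAB
    exact hi (by simpa [ι, SpecialLinearGroup.map_apply_coe] using this)
  have hmem : ∀ g, Φ g ∈ ι.range := by
    have hle : Subgroup.closure Y ≤ ι.range.comap Φ := by
      rw [Subgroup.closure_le]
      intro y hy
      choose c hc using h y hy
      have hdet : (Matrix.of c).det = 1 := by
        apply hi
        rw [RingHom.map_det, map_one, ← (Φ y).det_coe]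
        congr 1
        ext a b
        simp [hc]
      refine ⟨⟨Matrix.of c, hdet⟩, ?_⟩
      ext a b
      exact hc a b
    intro g
    exact hle (hY ▸ Subgroup.mem_top g)
  let e := MonoidHom.ofInjective hι
  refine ⟨(e.symm : ι.range →* _).comp (Φ.codRestrict ι.range hmem), fun g => ?_⟩
  have := e.apply_symm_apply (Φ.codRestrict ι.range hmem g)
  exact congrArg Subtype.val this

end SpecialLinear

section NumberFieldLinear

open NumberField Matrix

variable {L : Type*} [Field L] [NumberField L]

/-- Reduction of a linear representation modulo a prime at which it is integral. -/
theorem exists_normal_index_le_of_prime {n : ℕ} (hn : 1 ≤ n) {G : Type*} [Group G]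
    (Φ : G →* SpecialLinearGroup (Fin n) L) (Y : Set G) (hY : Subgroup.closure Y = ⊤)
    (P : Ideal (𝓞 L)) [hP : P.IsPrime] (hP0 : P ≠ ⊥) (d : 𝓞 L) (hd : d ∉ P)
    (hdY : ∀ y ∈ Y, ∀ a b, ∃ z : 𝓞 L, (z : L) = d * (Φ y).1 a b)
    (g : G) (a b : Fin n) (k : ℕ) (β : 𝓞 L) (hβ : β ∉ P)
    (hg : (β : L) = d ^ k * ((Φ g).1 a b - (1 : Matrix (Fin n) (Fin n) L) a b)) :
    ∃ H : Subgroup G, H.Normal ∧ H.FiniteIndex ∧ g ∉ H ∧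
      H.index ≤ 2 * Ideal.absNorm P ^ (n ^ 2 - 1) := by
  classical
  have hle : P.primeCompl ≤ nonZeroDivisors (𝓞 L) := Ideal.primeCompl_le_nonZeroDivisors P
  let D := Localization.subalgebra.ofField L P.primeCompl hle
  have : P.IsMaximal := hP.isMaximal hP0
  let : Field (𝓞 L ⧸ P) := Ideal.Quotient.field P
  have : Finite (𝓞 L ⧸ P) := finite_quotient_of_ne_bot hP0
  have hu : ∀ y : P.primeCompl, IsUnit (Ideal.Quotient.mk P y) := fun y => by
    rw [isUnit_iff_ne_zero, Ne, Ideal.Quotient.eq_zero_iff_mem]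
    exact y.2
  let r : D →+* 𝓞 L ⧸ P := IsLocalization.lift hu
  have hr : ∀ z : 𝓞 L, r (algebraMap (𝓞 L) D z) = Ideal.Quotient.mk P z :=
    fun z => IsLocalization.lift_eq hu z
  have hd0 : (d : L) ≠ 0 := fun h => hd (by
    have : d = 0 := by exact_mod_cast h
    rw [this]; exact P.zero_mem)
  obtain ⟨Ψ, hΨ⟩ := exists_lift_specialLinearGroup (D.val : D →+* L) Subtype.val_injective Φ Y hY
    (by
      intro y hy i j
      obtain ⟨z, hz⟩ := hdY y hy i j
      refine ⟨⟨(Φ y).1 i j, z, d, hd, ?_⟩, rfl⟩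
      change _ = (z : L) * (d : L)⁻¹
      rw [hz]
      field_simp)
  let f : G →* SpecialLinearGroup (Fin n) (𝓞 L ⧸ P) := (SpecialLinearGroup.map r).comp Ψ
  have hidx : f.ker.index ≤ 2 * Ideal.absNorm P ^ (n ^ 2 - 1) := by
    rw [Subgroup.index_ker]
    refine (Nat.card_le_card_of_injective _ Subtype.val_injective).trans ?_
    exact card_specialLinearGroup_le hn _
  refine ⟨f.ker, inferInstance, ?_, fun hk => hβ ?_, hidx⟩
  · refine ⟨?_⟩
    rw [Subgroup.index_ker]
    exact Nat.card_pos.ne'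
  · have h1 : r ((Ψ g).1 a b) = (1 : Matrix (Fin n) (Fin n) (𝓞 L ⧸ P)) a b :=
      congrArg (fun M : SpecialLinearGroup (Fin n) (𝓞 L ⧸ P) => M.1 a b) hk
    have h2 : ((Ψ g).1 a b : L) = (Φ g).1 a b :=
      congrArg (fun M : SpecialLinearGroup (Fin n) L => M.1 a b) (hΨ g)
    have h3 : algebraMap (𝓞 L) D β =
        algebraMap (𝓞 L) D d ^ k * ((Ψ g).1 a b - (1 : Matrix (Fin n) (Fin n) D) a b) := by
      apply Subtype.val_injective
      have h4 : (((1 : Matrix (Fin n) (Fin n) D) a b : D) : L) =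
          (1 : Matrix (Fin n) (Fin n) L) a b := by
        rw [one_apply, one_apply]; split_ifs <;> rfl
      change (β : L) = (d : L) ^ k * (((Ψ g).1 a b : L) - ((1 : Matrix (Fin n) (Fin n) D) a b : D))
      rw [hg, h2, h4]
    have h5 := congrArg r h3
    rw [hr, map_mul, map_sub, h1] at h5
    have h6 : r ((1 : Matrix (Fin n) (Fin n) D) a b) =
        (1 : Matrix (Fin n) (Fin n) (𝓞 L ⧸ P)) a b := by
      rw [one_apply, one_apply]; split_ifs <;> simp
    rw [h6, sub_self, mul_zero] at h5
    exact Ideal.Quotient.eq_zero_iff_mem.1 h5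

/-- Denominators and archimedean sizes of products of matrices with entries in a finite set grow
at most exponentially. -/
theorem exists_bound_matrix_list_prod (n : ℕ) (s : Finset L) :
    ∃ (d : 𝓞 L) (B : ℝ), d ≠ 0 ∧ 1 ≤ B ∧ (∀ σ : L →ₐ[ℚ] ℂ, ‖σ d‖ ≤ B) ∧
      (∀ x ∈ s, ∃ z : 𝓞 L, (z : L) = d * x) ∧
      ∀ l : List (Matrix (Fin n) (Fin n) L), (∀ M ∈ l, ∀ a b, M a b ∈ s) → ∀ a b,
        (∃ z : 𝓞 L, (z : L) = d ^ l.length * l.prod a b) ∧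
        ∀ σ : L →ₐ[ℚ] ℂ, ‖σ (l.prod a b)‖ ≤ (n * B) ^ l.length := by
  classical
  obtain ⟨⟨d, hd⟩, hds⟩ :=
    IsLocalization.exist_integer_multiples_of_finset (nonZeroDivisors (𝓞 L)) s
  have hs : ∀ x ∈ s, ∃ z : 𝓞 L, (z : L) = d * x := fun x hx => by
    obtain ⟨z, hz⟩ := hds x hx
    refine ⟨z, hz.trans ?_⟩
    simp [Algebra.smul_def]
  let T : Finset ℝ := ((insert (d : L) s) ×ˢ (Finset.univ : Finset (L →ₐ[ℚ] ℂ))).image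
    fun p => ‖p.2 p.1‖
  obtain ⟨B₀, hB₀⟩ := T.bddAbove
  have hT : ∀ x ∈ insert (d : L) s, ∀ σ : L →ₐ[ℚ] ℂ, ‖σ x‖ ≤ max B₀ 1 := fun x hx σ => by
    refine le_max_of_le_left (hB₀ ?_)
    rw [Finset.mem_coe, Finset.mem_image]
    exact ⟨(x, σ), by simp only [Finset.mem_product, Finset.mem_univ, and_true]; exact hx, rfl⟩
  have hB1 : 1 ≤ max B₀ 1 := le_max_right _ _
  refine ⟨d, max B₀ 1, nonZeroDivisors.ne_zero hd, hB1, hT _ (Finset.mem_insert_self _ _), hs, ?_⟩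
  intro l
  induction l with
  | nil =>
    intro _ a b
    simp only [List.length_nil, List.prod_nil, pow_zero, one_mul, one_apply]
    split_ifs
    · exact ⟨⟨1, by simp⟩, fun σ => by simp⟩
    · exact ⟨⟨0, by simp⟩, fun σ => by simp⟩
  | cons M l ih =>
    intro hl a b
    have ih' := ih fun M' hM' => hl M' (List.mem_cons_of_mem _ hM')
    have hM := hl M List.mem_cons_self
    rw [List.prod_cons, List.length_cons, mul_apply]
    constructor
    · choose u hu using fun c => hs _ (hM a c)
      choose v hv using fun c => (ih' c b).1
      refine ⟨∑ c, u c * v c, ?_⟩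
      have hsum : ((∑ c, u c * v c : 𝓞 L) : L) = ∑ c, (u c : L) * (v c : L) := by
        simp only [RingOfIntegers.coe_eq_algebraMap, map_sum, map_mul]
      rw [hsum, Finset.mul_sum]
      refine Finset.sum_congr rfl fun c _ => ?_
      rw [hu, hv]
      ring
    · intro σ
      rw [map_sum]
      refine (norm_sum_le _ _).trans ?_
      calc ∑ c, ‖σ (M a c * l.prod c b)‖
          ≤ ∑ _c : Fin n, max B₀ 1 * (n * max B₀ 1) ^ l.length := by
            refine Finset.sum_le_sum fun c _ => ?_
            rw [map_mul, norm_mul]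
            gcongr
            · exact hT _ (Finset.mem_insert_of_mem (hM a c)) σ
            · exact (ih' c b).2 σ
        _ = _ := by
            simp [pow_succ]
            ring

/-- Over a number field, a nontrivial matrix in a finitely generated linear group is detected by a
finite quotient whose order is polynomial in the word length, of degree `n ^ 2 - 1`. -/
theorem exists_normal_index_le_of_numberField {n : ℕ} (hn : 1 ≤ n) {G : Type*} [Group G]
    (Φ : G →* SpecialLinearGroup (Fin n) L) (Y : Finset G)
    (hY : Subgroup.closure (Y : Set G) = ⊤) :
    ∃ C : ℕ, ∀ N : ℕ, 1 ≤ N → ∀ l : List G, l.length ≤ N →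
      (∀ x ∈ l, x ∈ Y ∨ x⁻¹ ∈ Y) → Φ l.prod ≠ 1 →
      ∃ H : Subgroup G, H.Normal ∧ H.FiniteIndex ∧ l.prod ∉ H ∧ H.index ≤ C * N ^ (n ^ 2 - 1) := by
  classical
  let ent : SpecialLinearGroup (Fin n) L → Finset L := fun M =>
    Finset.univ.image fun p : Fin n × Fin n => M.1 p.1 p.2
  have hent : ∀ M a b, M.1 a b ∈ ent M := fun M a b =>
    Finset.mem_image.2 ⟨(a, b), Finset.mem_univ _, rfl⟩
  let s : Finset L := Y.biUnion fun y => ent (Φ y) ∪ ent (Φ y⁻¹)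
  have hs : ∀ y, (y ∈ Y ∨ y⁻¹ ∈ Y) → ∀ a b, (Φ y).1 a b ∈ s := by
    rintro y (hy | hy) a b
    · exact Finset.mem_biUnion.2 ⟨y, hy, Finset.mem_union_left _ (hent _ a b)⟩
    · refine Finset.mem_biUnion.2 ⟨y⁻¹, hy, Finset.mem_union_right _ ?_⟩
      rw [inv_inv]
      exact hent _ a b
  obtain ⟨d, B, hd0, hB, hdB, hds, hprod⟩ := exists_bound_matrix_list_prod n s
  obtain ⟨c, n₀, hc, hθ⟩ := exists_le_idealTheta L
  have hn' : (1 : ℝ) ≤ n := by exact_mod_cast hn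
  set E : ℝ := 2 * n * B ^ 3 with hE
  have hE1 : 1 ≤ E := by
    have : (1 : ℝ) ≤ B ^ 3 := one_le_pow₀ hB
    nlinarith
  set D := Module.finrank ℚ L
  obtain ⟨A₀, hA₀⟩ := exists_nat_gt (D * Real.log E / c)
  set A := max A₀ (max n₀ 1)
  have hA : D * Real.log E < c * A := by
    rw [div_lt_iff₀ hc] at hA₀
    calc _ < _ := hA₀
      _ = c * A₀ := mul_comm _ _
      _ ≤ _ := by
        gcongr
        exact_mod_cast le_max_left _ _
  refine ⟨2 * A ^ (n ^ 2 - 1), fun N hN l hlN hl hne => ?_⟩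
  set k := l.length with hk
  let m : List (Matrix (Fin n) (Fin n) L) := l.map fun x => (Φ x).1
  have hm : m.prod = (Φ l.prod).1 := by
    exact (map_list_prod (SpecialLinearGroup.coeMonoidHom.comp Φ) l).symm
  have hmk : m.length = k := List.length_map _
  have hms : ∀ M ∈ m, ∀ a b, M a b ∈ s := by
    intro M hM a b
    obtain ⟨x, hx, rfl⟩ := List.mem_map.1 hM
    exact hs x (hl x hx) a b
  obtain ⟨a, b, hab⟩ : ∃ a b, (Φ l.prod).1 a b ≠ (1 : Matrix (Fin n) (Fin n) L) a b := by
    by_contra! h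
    exact hne (Subtype.ext (Matrix.ext h))
  obtain ⟨⟨z, hz⟩, hσ⟩ := hprod m hms a b
  rw [hm, hmk] at hz hσ
  obtain ⟨ε, hε, hεσ⟩ : ∃ ε : 𝓞 L, (ε : L) = (1 : Matrix (Fin n) (Fin n) L) a b ∧
      ∀ σ : L →ₐ[ℚ] ℂ, ‖σ ε‖ ≤ 1 := by
    rw [one_apply]
    split_ifs
    · exact ⟨1, by simp, fun σ => by simp⟩
    · exact ⟨0, by simp, fun σ => by simp⟩
  set β : 𝓞 L := z - d ^ k * ε with hβdef
  have hβ : (β : L) = d ^ k * ((Φ l.prod).1 a b - (1 : Matrix (Fin n) (Fin n) L) a b) := by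
    rw [hβdef, mul_sub, ← hz, ← hε]
    simp
  have hd0' : (d : L) ≠ 0 := by exact_mod_cast hd0
  have hβ0 : β ≠ 0 := by
    intro h
    have : (β : L) = 0 := by rw [h]; simp
    rw [hβ] at this
    exact mul_ne_zero (pow_ne_zero _ hd0') (sub_ne_zero.2 hab) this
  have hbound : ∀ σ : L →ₐ[ℚ] ℂ, ‖σ ((β * d : 𝓞 L) : L)‖ ≤ E ^ N := by
    intro σ
    have h1 : ((β * d : 𝓞 L) : L) =
        d ^ k * ((Φ l.prod).1 a b - (ε : L)) * d := by
      rw [hε, ← hβ]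
      simp only [RingOfIntegers.coe_eq_algebraMap, map_mul]
    have hnB : 1 ≤ n * B := by nlinarith
    rw [h1, map_mul, map_mul, map_pow, map_sub, norm_mul, norm_mul, norm_pow]
    calc ‖σ d‖ ^ k * ‖σ ((Φ l.prod).1 a b) - σ ε‖ * ‖σ d‖
        ≤ B ^ N * (2 * (n * B) ^ N) * B ^ N := by
          have h2 : ‖σ ((Φ l.prod).1 a b) - σ ε‖ ≤ 2 * (n * B) ^ N := by
            calc _ ≤ ‖σ ((Φ l.prod).1 a b)‖ + ‖σ ε‖ := norm_sub_le _ _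
              _ ≤ (n * B) ^ k + 1 := add_le_add (hσ σ) (hεσ σ)
              _ ≤ (n * B) ^ N + (n * B) ^ N := by
                gcongr ?_ + ?_
                · exact pow_le_pow_right₀ hnB hlN
                · exact one_le_pow₀ hnB
              _ = _ := by ring
          have h3 : ‖σ d‖ ^ k ≤ B ^ N :=
            (pow_le_pow_left₀ (norm_nonneg _) (hdB σ) k).trans (pow_le_pow_right₀ hB hlN)
          have h4 : ‖σ d‖ ≤ B ^ N := (hdB σ).trans (le_self_pow₀ hB (by omega))
          gcongr
      _ ≤ B ^ N * (2 ^ N * (n * B) ^ N) * B ^ N := by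
          gcongr
          exact le_self_pow₀ one_le_two (by omega)
      _ = E ^ N := by
          rw [hE, ← mul_pow, ← mul_pow, ← mul_pow]
          congr 1
          ring
  have hI : Ideal.span {β * d} ≠ ⊥ := by
    rw [Ne, Ideal.span_singleton_eq_bot]
    exact mul_ne_zero hβ0 hd0
  have hlog : Real.log (Ideal.absNorm (Ideal.span {β * d})) ≤ D * Real.log E * N := by
    calc _ ≤ Real.log ((E ^ N) ^ D) := by
          refine Real.log_le_log ?_ (absNorm_span_singleton_le hbound)
          exact_mod_cast absNorm_pos_of_ne_bot hI
      _ = _ := by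
          rw [Real.log_pow, Real.log_pow]
          ring
  have hθN := hθ (A * N) (by
    calc n₀ ≤ A := (le_max_left _ _).trans (le_max_right _ _)
      _ ≤ A * N := Nat.le_mul_of_pos_right _ hN)
  obtain ⟨P, hPmem, hP⟩ : ∃ P ∈ primesUpTo L (A * N), ¬ Ideal.span {β * d} ≤ P := by
    by_contra! h
    have h1 := sum_log_absNorm_le hI (primesUpTo L (A * N)) fun P hP =>
      ⟨(mem_primesUpTo.1 hP).2.1, (mem_primesUpTo.1 hP).2.2, h P hP⟩
    have h2 : idealTheta L (A * N) ≤ D * Real.log E * N := h1.trans hlog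
    have h3 : (D * Real.log E) * N < (c * A) * N := by
      gcongr
    push_cast at hθN
    linarith
  obtain ⟨hPn, hPp, hP0⟩ := mem_primesUpTo.1 hPmem
  rw [Ideal.span_singleton_le_iff_mem] at hP
  obtain ⟨H, hH, hHf, hgH, hHi⟩ := exists_normal_index_le_of_prime hn Φ Y hY P hP0 d
    (fun h => hP (P.mul_mem_left _ h))
    (fun y hy i j => hds _ (hs y (Or.inl hy) i j)) l.prod a b k β
    (fun h => hP (P.mul_mem_right _ h)) hβ
  refine ⟨H, hH, hHf, hgH, hHi.trans ?_⟩
  calc _ ≤ 2 * (A * N) ^ (n ^ 2 - 1) := by gcongr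
    _ = _ := by rw [mul_pow]; ring

end NumberFieldLinear

section Specialization

open Matrix

/-- A nontrivial finitely generated algebra over a number field maps to a number field. -/
theorem exists_ringHom_numberField {K : Type*} [Field K] [NumberField K] (B : Type)
    [CommRing B] [Nontrivial B] [Algebra K B] [Algebra.FiniteType K B] :
    ∃ (L : Type) (_ : Field L) (_ : NumberField L), Nonempty (B →+* L) := by
  obtain ⟨m, hm⟩ := Ideal.exists_maximal B
  let F : Field (B ⧸ m) := Ideal.Quotient.field m
  have hft : Algebra.FiniteType K (B ⧸ m) :=
    Algebra.FiniteType.of_surjective (Ideal.Quotient.mkₐ K m) (Ideal.Quotient.mkₐ_surjective K m)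
  have hfin : Module.Finite K (B ⧸ m) := finite_of_finite_type_of_isJacobsonRing K (B ⧸ m)
  have hchar : CharZero (B ⧸ m) := charZero_of_injective_algebraMap
    (algebraMap K (B ⧸ m)).injective
  have hQ : FiniteDimensional ℚ (B ⧸ m) := Module.Finite.trans K (B ⧸ m)
  exact ⟨B ⧸ m, F, ⟨⟩, ⟨Ideal.Quotient.mk m⟩⟩

/-- A finitely generated subgroup of `SL_n(ℂ)` has a representation over a number field which is
faithful on the elements with entries in a given number field `K`. -/
theorem exists_numberField_specialization {n : ℕ} (K : Subfield ℂ) [FiniteDimensional ℚ K]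
    (Γ : Subgroup (SpecialLinearGroup (Fin n) ℂ)) (Y : Finset Γ)
    (hY : Subgroup.closure (Y : Set Γ) = ⊤) :
    ∃ (L : Type) (_ : Field L) (_ : NumberField L) (Φ : Γ →* SpecialLinearGroup (Fin n) L),
      ∀ g : Γ, (∀ a b, g.1.1 a b ∈ K) → Φ g = 1 → g = 1 := by
  classical
  let s : Finset ℂ := Y.biUnion fun y =>
    Finset.univ.image fun p : Fin n × Fin n => y.1.1 p.1 p.2
  let B := Algebra.adjoin K (s : Set ℂ)
  have hBft : Algebra.FiniteType K B :=
    (Subalgebra.fg_iff_finiteType _).1 (Subalgebra.fg_adjoin_finset s)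
  obtain ⟨Ψ, hΨ⟩ := exists_lift_specialLinearGroup (B.val : B →+* ℂ) Subtype.val_injective
    Γ.subtype (Y : Set Γ) hY (by
      intro y hy a b
      exact ⟨⟨y.1.1 a b, Algebra.subset_adjoin (Finset.mem_coe.2 (Finset.mem_biUnion.2
        ⟨y, hy, Finset.mem_image.2 ⟨(a, b), Finset.mem_univ _, rfl⟩⟩))⟩, rfl⟩)
  have hK : NumberField K := ⟨⟩
  obtain ⟨L, _, _, ⟨r⟩⟩ := exists_ringHom_numberField (K := K) B
  let φ : K →+* L := r.comp (algebraMap K B)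
  refine ⟨L, inferInstance, inferInstance, (SpecialLinearGroup.map r).comp Ψ, fun g hg h => ?_⟩
  ext a b
  have h1 : r ((Ψ g).1 a b) = (1 : Matrix (Fin n) (Fin n) L) a b :=
    congrArg (fun M : SpecialLinearGroup (Fin n) L => M.1 a b) h
  have h2 : ((Ψ g).1 a b : ℂ) = g.1.1 a b :=
    congrArg (fun M : SpecialLinearGroup (Fin n) ℂ => M.1 a b) (hΨ g)
  have h3 : (Ψ g).1 a b = algebraMap K B ⟨g.1.1 a b, hg a b⟩ := Subtype.val_injective h2
  have h4 : φ ⟨g.1.1 a b, hg a b⟩ =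
      φ ((1 : Matrix (Fin n) (Fin n) K) a b) := by
    rw [RingHom.comp_apply, ← h3, h1, one_apply, one_apply]
    split_ifs <;> simp
  have h5 : (⟨g.1.1 a b, hg a b⟩ : K) = (1 : Matrix (Fin n) (Fin n) K) a b :=
    φ.injective h4
  have h6 := congrArg (Subtype.val : K → ℂ) h5
  change g.1.1 a b = (1 : Matrix (Fin n) (Fin n) ℂ) a b
  refine h6.trans ?_
  rw [one_apply, one_apply]
  split_ifs <;> rfl

/-- A finitely generated subgroup of `SL_n(ℂ)` which virtually has entries in a number field `K`
satisfies a polynomial bound of degree `n ^ 2 - 1` on the order of detecting finite quotients. -/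
theorem exists_normal_index_le_of_finiteIndex {n : ℕ} (hn : 1 ≤ n) (K : Subfield ℂ)
    [FiniteDimensional ℚ K] (Γ : Subgroup (SpecialLinearGroup (Fin n) ℂ)) (Δ : Subgroup Γ)
    [Δ.FiniteIndex] (hΔ : ∀ g ∈ Δ, ∀ a b, g.1.1 a b ∈ K) (Y : Finset Γ)
    (hY : Subgroup.closure (Y : Set Γ) = ⊤) :
    ∃ C : ℕ, ∀ N : ℕ, 1 ≤ N → ∀ l : List Γ, l.length ≤ N →
      (∀ x ∈ l, x ∈ Y ∨ x⁻¹ ∈ Y) → l.prod ≠ 1 →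
      ∃ H : Subgroup Γ, H.Normal ∧ H.FiniteIndex ∧ l.prod ∉ H ∧ H.index ≤ C * N ^ (n ^ 2 - 1) := by
  obtain ⟨L, _, _, Φ, hΦ⟩ := exists_numberField_specialization K Γ Y hY
  obtain ⟨C, hC⟩ := exists_normal_index_le_of_numberField hn Φ Y hY
  refine ⟨max C Δ.normalCore.index, fun N hN l hlN hl hne => ?_⟩
  by_cases hmem : l.prod ∈ Δ.normalCore
  · obtain ⟨H, h1, h2, h3, h4⟩ := hC N hN l hlN hl fun h =>
      hne (hΦ _ (hΔ _ (Δ.normalCore_le hmem)) h)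
    exact ⟨H, h1, h2, h3, h4.trans (Nat.mul_le_mul_right _ (le_max_left _ _))⟩
  · refine ⟨Δ.normalCore, inferInstance, inferInstance, hmem, ?_⟩
    exact (le_max_right _ _).trans (Nat.le_mul_of_pos_right _ (Nat.pow_pos hN))

end Specialization

section WordLength

variable {G : Type*} [Group G]

theorem exists_list_length_eq_wordLength {Y : Set G} (hY : Subgroup.closure Y = ⊤) (g : G) :
    ∃ l : List G, l.length = wordLength Y g ∧ (∀ x ∈ l, x ∈ Y ∨ x⁻¹ ∈ Y) ∧ l.prod = g := by
  refine Nat.sInf_mem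
    (s := {n | ∃ l : List G, l.length = n ∧ (∀ x ∈ l, x ∈ Y ∨ x⁻¹ ∈ Y) ∧ l.prod = g}) ?_
  have hg : g ∈ (Subgroup.closure Y).toSubmonoid := hY ▸ Subgroup.mem_top g
  rw [Subgroup.closure_toSubmonoid] at hg
  obtain ⟨l, hl, rfl⟩ := Submonoid.exists_list_of_mem_closure hg
  exact ⟨_, l, rfl, hl, rfl⟩

theorem farbD_le_index {g : G} {H : Subgroup G} (h : H.Normal) (hf : H.FiniteIndex) (hg : g ∉ H) :
    farbD g ≤ H.index :=
  Nat.sInf_le ⟨H, h, hf, hg, rfl⟩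

end WordLength

theorem awayIn_ringOfIntegersIn_le {K : Subfield ℂ} {b : ℂ} (hb : b ∈ ringOfIntegersIn K) :
    awayIn (ringOfIntegersIn K) b ≤ K.toSubring := by
  rw [awayIn, Subring.closure_le, Set.union_subset_iff, Set.singleton_subset_iff]
  exact ⟨fun x hx => hx.2, K.inv_mem hb.2⟩

/-- upper bound for finitely generated subgroups of `SL_n(ℂ)`
commensurable into `SL_n(𝓞_{K,b})`. -/
theorem farb_growth_upper_bound_SL (n : ℕ) (hn : 2 ≤ n) (K : Subfield ℂ)
    (hK : FiniteDimensional ℚ K) (b : ℂ) (hb : b ∈ ringOfIntegersIn K) (hb0 : b ≠ 0)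
    (Γ : Subgroup (Matrix.SpecialLinearGroup (Fin n) ℂ)) (hfg : Group.FG Γ)
    (hidx : ((slOver n (awayIn (ringOfIntegersIn K) b)).subgroupOf Γ).FiniteIndex) :
    ResiduallyFinite Γ ∧
      ∀ Y : Finset Γ, Subgroup.closure (Y : Set Γ) = ⊤ →
        FarbPreceq (farbF (Y : Set Γ)) (fun N => N ^ (n ^ 2 - 1)) := by
  have hΔ : ∀ g ∈ (slOver n (awayIn (ringOfIntegersIn K) b)).subgroupOf Γ,
      ∀ i j, g.1.1 i j ∈ K := by
    intro g hg i j
    obtain ⟨M, hM⟩ := Subgroup.mem_subgroupOf.1 hg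
    rw [← hM]
    exact awayIn_ringOfIntegersIn_le hb (M.1 i j).2
  refine ⟨?_, fun Y hY => ?_⟩
  · obtain ⟨Y, hY⟩ := (Group.fg_def.1 hfg)
    obtain ⟨C, hC⟩ := exists_normal_index_le_of_finiteIndex (by omega) K Γ _ hΔ Y hY
    intro g hg
    obtain ⟨l, -, hl, rfl⟩ := exists_list_length_eq_wordLength hY g
    obtain ⟨H, h1, h2, h3, -⟩ := hC (l.length + 1) (by omega) l (by omega) hl hg
    exact ⟨H, h1, h2, h3⟩
  · obtain ⟨C, hC⟩ := exists_normal_index_le_of_finiteIndex (by omega) K Γ _ hΔ Y hY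
    refine ⟨C + 1, by omega, fun N => csSup_le' ?_⟩
    rintro _ ⟨g, hg, hgN, rfl⟩
    obtain ⟨l, hlen, hl, rfl⟩ := exists_list_length_eq_wordLength hY g
    have hN : 1 ≤ N := by
      rcases Nat.eq_zero_or_pos N with rfl | h
      · have h0 : l = [] := List.length_eq_zero_iff.1 (by omega)
        exact absurd (by simp [h0]) hg
      · exact h
    obtain ⟨H, h1, h2, h3, h4⟩ := hC N hN l (by omega) hl hg
    refine (farbD_le_index h1 h2 h3).trans (h4.trans ?_)
    exact Nat.mul_le_mul (Nat.le_succ C)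
      (Nat.pow_le_pow_left (Nat.le_mul_of_pos_left N (Nat.succ_pos C)) _)
end

section
/- Let Γ = (⨁_{i ∈ ℤ} ℤ/2ℤ) ⋊ ℤ be the lamplighter group ℤ/2ℤ ≀ ℤ, where the generator of ℤ acts on the direct sum ⨁_{i ∈ ℤ} ℤ/2ℤ by shifting the index. Then for every finite generating set X of Γ one has F_{Γ,X}(n) ≽ (log n)². (Example 2.1.) -/
open scoped Pointwise

/-- The shift automorphism of `⨁_{i ∈ ℤ} ℤ/2ℤ`, sending `δ_i` to `δ_{i+1}`. -/
noncomputable def lampShift : AddAut (ℤ →₀ ZMod 2) :=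
  (Finsupp.domCongr (Equiv.addRight (1 : ℤ)) : (ℤ →₀ ZMod 2) ≃+ (ℤ →₀ ZMod 2))

/-- The action of `ℤ` on the base group of the lamplighter group by shifts. -/
noncomputable def lampAction :
    Multiplicative ℤ →* MulAut (Multiplicative (ℤ →₀ ZMod 2)) :=
  zpowersHom _ (AddEquiv.toMultiplicative lampShift : MulAut (Multiplicative (ℤ →₀ ZMod 2)))

/-- The lamplighter group `ℤ/2ℤ ≀ ℤ = (⨁_{i ∈ ℤ} ℤ/2ℤ) ⋊ ℤ`. -/
noncomputable abbrev Lamplighter :=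
  SemidirectProduct (Multiplicative (ℤ →₀ ZMod 2)) (Multiplicative ℤ) lampAction

section WordLength

variable {G : Type*} [Group G] {X : Set G}

lemma exists_word_of_closure_eq_top (hX : Subgroup.closure X = ⊤) (g : G) :
    ∃ l : List G, l.length = wordLength X g ∧ (∀ x ∈ l, x ∈ X ∨ x⁻¹ ∈ X) ∧ l.prod = g := by
  have hg : g ∈ (Subgroup.closure X).toSubmonoid := hX ▸ Subgroup.mem_top g
  rw [Subgroup.closure_toSubmonoid] at hg
  obtain ⟨l, hl, hp⟩ := Submonoid.exists_list_of_mem_closure hg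
  exact Nat.sInf_mem (s := {n | ∃ l : List G, l.length = n ∧ (∀ x ∈ l, x ∈ X ∨ x⁻¹ ∈ X) ∧
    l.prod = g}) ⟨l.length, l, rfl, hl, hp⟩

lemma wordLength_prod_le {l : List G} (hl : ∀ x ∈ l, x ∈ X ∨ x⁻¹ ∈ X) :
    wordLength X l.prod ≤ l.length :=
  Nat.sInf_le ⟨l, rfl, hl, rfl⟩

lemma wordLength_one : wordLength X 1 = 0 := by
  simpa using wordLength_prod_le (X := X) (l := []) (by simp)

lemma wordLength_mul_le (hX : Subgroup.closure X = ⊤) (g h : G) :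
    wordLength X (g * h) ≤ wordLength X g + wordLength X h := by
  obtain ⟨l, hl, hlX, rfl⟩ := exists_word_of_closure_eq_top hX g
  obtain ⟨m, hm, hmX, rfl⟩ := exists_word_of_closure_eq_top hX h
  rw [← hl, ← hm, ← List.prod_append, ← List.length_append]
  refine wordLength_prod_le fun x hx => ?_
  rcases List.mem_append.1 hx with h | h
  exacts [hlX x h, hmX x h]

lemma wordLength_inv_le (hX : Subgroup.closure X = ⊤) (g : G) :
    wordLength X g⁻¹ ≤ wordLength X g := by
  obtain ⟨l, hl, hlX, rfl⟩ := exists_word_of_closure_eq_top hX g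
  rw [← hl, List.prod_inv_reverse]
  refine (wordLength_prod_le fun x hx => ?_).trans (by simp)
  obtain ⟨y, hy, rfl⟩ := List.mem_map.1 (List.mem_reverse.1 hx)
  simpa using (hlX y hy).symm

lemma wordLength_pow_le (hX : Subgroup.closure X = ⊤) (g : G) (n : ℕ) :
    wordLength X (g ^ n) ≤ n * wordLength X g := by
  induction n with
  | zero => simp [wordLength_one]
  | succ n ih =>
    rw [pow_succ, Nat.succ_mul]
    exact (wordLength_mul_le hX _ _).trans (by gcongr)

lemma finite_setOf_wordLength_le (hfin : X.Finite) (hX : Subgroup.closure X = ⊤) (n : ℕ) :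
    {g : G | wordLength X g ≤ n}.Finite := by
  have hY : {x : G | x ∈ X ∨ x⁻¹ ∈ X}.Finite := hfin.union hfin.inv
  have : Finite {x : G | x ∈ X ∨ x⁻¹ ∈ X} := hY
  refine ((List.finite_length_le {x : G | x ∈ X ∨ x⁻¹ ∈ X} n).image
    fun l => (l.map Subtype.val).prod).subset fun g hg => ?_
  obtain ⟨l, hl, hlX, rfl⟩ := exists_word_of_closure_eq_top hX g
  lift l to List {x : G | x ∈ X ∨ x⁻¹ ∈ X} using hlX
  refine ⟨l, ?_, rfl⟩
  change wordLength X _ ≤ n at hg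
  rwa [← hl, List.length_map] at hg

lemma farbD_le_farbF (hfin : X.Finite) (hX : Subgroup.closure X = ⊤) {g : G} (hg : g ≠ 1)
    {n : ℕ} (hn : wordLength X g ≤ n) : farbD g ≤ farbF X n := by
  refine le_csSup (Set.Finite.bddAbove ?_) ⟨g, hg, hn, rfl⟩
  refine ((finite_setOf_wordLength_le hfin hX n).image farbD).subset ?_
  rintro d ⟨g, -, hg, rfl⟩
  exact ⟨g, hg, rfl⟩

end WordLength

lemma lampAction_ofAdd_apply (n : ℤ) (f : ℤ →₀ ZMod 2) (i : ℤ) :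
    (lampAction (.ofAdd n) (.ofAdd f)).toAdd i = f (i - n) := by
  have shift_apply (f : ℤ →₀ ZMod 2) (i : ℤ) : lampShift f i = f (i - 1) := by
    simp [lampShift, sub_eq_add_neg]
  have hone (f : Multiplicative (ℤ →₀ ZMod 2)) (i : ℤ) :
      (lampAction (.ofAdd 1) f).toAdd i = f.toAdd (i - 1) := by
    rw [← shift_apply]
    simp [lampAction]
  induction n generalizing f i with
  | zero => simp
  | succ n ih =>
    rw [add_comm, ofAdd_add, map_mul, MulAut.mul_apply, hone, ← ofAdd_toAdd (lampAction _ _),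
      toAdd_ofAdd, ih]
    congr 1; ring
  | pred n ih =>
    have h := hone (lampAction (.ofAdd (-(n : ℤ) - 1)) (.ofAdd f)) (i + 1)
    rw [← MulAut.mul_apply, ← map_mul, ← ofAdd_add, add_sub_cancel, ih, add_sub_cancel_right] at h
    rw [← h]
    congr 1; ring

/-- Translation by `n` on `⨁_{i ∈ ℤ} ℤ/2ℤ`, sending `δ_i` to `δ_{i+n}`. -/
noncomputable def lampTranslate (n : ℤ) : (ℤ →₀ ZMod 2) ≃+ (ℤ →₀ ZMod 2) :=
  Finsupp.domCongr (Equiv.addRight n)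

lemma lampTranslate_apply (n : ℤ) (f : ℤ →₀ ZMod 2) (i : ℤ) :
    lampTranslate n f i = f (i - n) := by
  simp [lampTranslate, sub_eq_add_neg]

lemma lampTranslate_comm (m n : ℤ) (f : ℤ →₀ ZMod 2) :
    lampTranslate m (lampTranslate n f) = lampTranslate n (lampTranslate m f) := by
  ext i
  simp [lampTranslate_apply, sub_right_comm]

lemma lampAction_ofAdd (n : ℤ) (f : ℤ →₀ ZMod 2) :
    lampAction (.ofAdd n) (.ofAdd f) = .ofAdd (lampTranslate n f) := by
  apply Multiplicative.toAdd.injective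
  ext i
  rw [lampAction_ofAdd_apply, toAdd_ofAdd, lampTranslate_apply]

namespace Lamplighter

/-- The lamp configuration `f` as an element of the lamplighter group. -/
noncomputable def base (f : ℤ →₀ ZMod 2) : Lamplighter :=
  SemidirectProduct.inl (.ofAdd f)

/-- The generator of `ℤ` in the lamplighter group. -/
noncomputable def step : Lamplighter := SemidirectProduct.inr (.ofAdd 1)

lemma base_add (f g : ℤ →₀ ZMod 2) : base (f + g) = base f * base g := by
  simp [base]

lemma base_sub (f g : ℤ →₀ ZMod 2) : base (f - g) = base f * (base g)⁻¹ := by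
  rw [eq_mul_inv_iff_mul_eq, ← base_add, sub_add_cancel]

lemma base_zero : base 0 = 1 := by
  simp [base]

lemma step_pow_conj (n : ℕ) (f : ℤ →₀ ZMod 2) :
    step ^ n * base f * (step ^ n)⁻¹ = base (lampTranslate n f) := by
  have : step ^ n = SemidirectProduct.inr (.ofAdd (n : ℤ)) := by
    rw [step, ← map_pow, ← ofAdd_nsmul]
    simp
  rw [this, base, base, ← lampAction_ofAdd, SemidirectProduct.inl_aut, map_inv]

lemma wordLength_base_le {X : Set Lamplighter} (hX : Subgroup.closure X = ⊤) {B : ℕ}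
    (ha : wordLength X (base (Finsupp.single 0 1)) ≤ B) (ht : wordLength X step ≤ B)
    (L : ℕ) (f : ℤ →₀ ZMod 2) (hf : ∀ i, f i ≠ 0 → 0 ≤ i ∧ i < L) :
    wordLength X (base f) ≤ L * (B * (2 * L + 1)) := by
  induction L generalizing f with
  | zero =>
    have : f = 0 := by
      ext i
      by_contra h
      have := hf i h
      simp at this
      omega
    simp [this, base_zero, wordLength_one]
  | succ L ih =>
    rw [← Finsupp.erase_add_single (L : ℤ) f, base_add]
    refine (wordLength_mul_le hX _ _).trans ?_
    have h1 : wordLength X (base (f.erase (L : ℤ))) ≤ L * (B * (2 * L + 1)) := by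
      refine ih _ fun i hi => ?_
      have hiL : i ≠ L := by
        rintro rfl
        simp at hi
      rw [Finsupp.erase_ne hiL] at hi
      have := hf i hi
      push_cast at this
      omega
    have h2 : wordLength X (base (Finsupp.single (L : ℤ) (f L))) ≤ B * (2 * L + 1) := by
      have key : ∀ c : ZMod 2, c = 0 ∨ c = 1 := by decide
      rcases key (f L) with h | h
      · simp [h, base_zero, wordLength_one]
      · have : Finsupp.single (L : ℤ) (1 : ZMod 2) = lampTranslate L (Finsupp.single 0 1) := by
          simp [lampTranslate, Finsupp.domCongr_apply]
        rw [h, this, ← step_pow_conj]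
        have e1 := wordLength_mul_le hX (step ^ L * base (Finsupp.single 0 1)) (step ^ L)⁻¹
        have e2 := wordLength_mul_le hX (step ^ L) (base (Finsupp.single 0 1))
        have e3 := wordLength_inv_le hX (step ^ L)
        have e4 := wordLength_pow_le hX step L
        have e5 : L * wordLength X step ≤ L * B := by gcongr
        linarith
    calc _ ≤ L * (B * (2 * L + 1)) + B * (2 * L + 1) := add_le_add h1 h2
      _ = (L + 1) * (B * (2 * L + 1)) := by ring
      _ ≤ (L + 1) * (B * (2 * (L + 1) + 1)) := by gcongr; omega

/-- The configuration corresponding to the polynomial `∏_{j = 1}^{D} (t ^ j - 1)`. -/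
noncomputable def cyclotomicLamp : ℕ → (ℤ →₀ ZMod 2)
  | 0 => Finsupp.single 0 1
  | D + 1 => lampTranslate ((D + 1 : ℕ) : ℤ) (cyclotomicLamp D) - cyclotomicLamp D

lemma cyclotomicLamp_support (D : ℕ) (i : ℤ) (hi : cyclotomicLamp D i ≠ 0) :
    0 ≤ i ∧ i < ((D + 1) ^ 2 : ℕ) := by
  induction D generalizing i with
  | zero =>
    have : i = 0 := by
      by_contra h
      simp [cyclotomicLamp, Ne.symm h] at hi
    simp [this]
  | succ D ih =>
    have : cyclotomicLamp D (i - (D + 1 : ℕ)) ≠ 0 ∨ cyclotomicLamp D i ≠ 0 := by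
      by_contra! h
      simp [cyclotomicLamp, lampTranslate_apply, h.2] at hi
      exact hi (by simpa using h.1)
    rcases this with h | h <;> have := ih _ h <;> push_cast at this ⊢ <;>
      constructor <;> nlinarith [this.1, this.2, Int.natCast_nonneg D]

lemma exists_cyclotomicLamp_eq {D k : ℕ} (hk : 1 ≤ k) (hkD : k ≤ D) :
    ∃ q, cyclotomicLamp D = lampTranslate k q - q := by
  induction D, hkD using Nat.le_induction with
  | base =>
    obtain ⟨k, rfl⟩ : ∃ j, k = j + 1 := ⟨k - 1, by omega⟩
    exact ⟨_, rfl⟩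
  | succ D _ ih =>
    obtain ⟨q, hq⟩ := ih
    refine ⟨lampTranslate ((D + 1 : ℕ) : ℤ) q - q, ?_⟩
    rw [cyclotomicLamp, hq, map_sub, map_sub, lampTranslate_comm]
    abel

lemma base_cyclotomicLamp_mem {D : ℕ} {N : Subgroup Lamplighter} [N.Normal]
    (h0 : N.index ≠ 0) (hD : N.index ≤ D) : base (cyclotomicLamp D) ∈ N := by
  obtain ⟨q, hq⟩ := exists_cyclotomicLamp_eq (Nat.one_le_iff_ne_zero.2 h0) hD
  have hs : step ^ N.index ∈ N := N.pow_index_mem step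
  rw [hq, base_sub, ← step_pow_conj, mul_assoc, mul_assoc, ← mul_assoc (base q)]
  exact N.mul_mem hs (Subgroup.Normal.conj_mem ‹_› _ (N.inv_mem hs) _)

section Evaluation

variable {R : Type*} [CommRing R] [CharP R 2]

/-- Evaluation at a unit `u` of a configuration, viewed as a Laurent polynomial. -/
noncomputable def lampEval (u : Rˣ) : (ℤ →₀ ZMod 2) →+ R :=
  Finsupp.liftAddHom fun i =>
    (AddMonoidHom.mulRight ((u ^ i : Rˣ) : R)).comp (ZMod.castHom dvd_rfl R).toAddMonoidHom

lemma lampEval_single (u : Rˣ) (i : ℤ) :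
    lampEval u (Finsupp.single i 1) = ((u ^ i : Rˣ) : R) := by
  simp [lampEval]

lemma lampEval_translate (u : Rˣ) (n : ℤ) (f : ℤ →₀ ZMod 2) :
    lampEval u (lampTranslate n f) = ((u ^ n : Rˣ) : R) * lampEval u f := by
  induction f using Finsupp.induction_linear with
  | zero => simp
  | add f g hf hg => simp only [map_add, hf, hg, mul_add]
  | single i c =>
    have : lampTranslate n (Finsupp.single i c) = Finsupp.single (i + n) c := by
      simp [lampTranslate, Finsupp.domCongr_apply]
    rw [this]
    simp only [lampEval, Finsupp.liftAddHom_apply_single, AddMonoidHom.comp_apply,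
      AddMonoidHom.mulRight_apply, zpow_add, Units.val_mul]
    ring

/-- The affine action of the lamplighter group on `R` in which `ℤ` acts through a unit. -/
noncomputable def affineHom (u : Rˣ) : Lamplighter →* Equiv.Perm R :=
  SemidirectProduct.lift
    (MonoidHom.mk' (fun f => Equiv.addLeft (lampEval u f.toAdd)) fun f g => by
      ext x
      simp)
    (zpowersHom _ (Units.mulLeft u)) <| by
      intro n
      have hz (n : ℤ) (x : R) : ((Units.mulLeft u) ^ n) x = ((u ^ n : Rˣ) : R) * x := by
        induction n generalizing x with
        | zero => simp
        | succ n ih => rw [zpow_add_one, Equiv.Perm.mul_apply, ih, zpow_add_one]; simp [mul_assoc]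
        | pred n ih => rw [zpow_sub_one, Equiv.Perm.mul_apply, ih, zpow_sub_one]; simp [mul_assoc]
      refine MonoidHom.ext fun f => Equiv.ext fun x => ?_
      have h := lampAction_ofAdd n.toAdd f.toAdd
      simp only [ofAdd_toAdd] at h
      change lampEval u (lampAction n f).toAdd + x = (Units.mulLeft u ^ n.toAdd *
        Equiv.addLeft (lampEval u f.toAdd) * (Units.mulLeft u ^ n.toAdd)⁻¹) x
      rw [h, toAdd_ofAdd, lampEval_translate, ← zpow_neg, Equiv.Perm.mul_apply,
        Equiv.Perm.mul_apply, hz, hz, Equiv.coe_addLeft, mul_add, ← mul_assoc, ← Units.val_mul,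
        ← zpow_add, add_neg_cancel, zpow_zero, Units.val_one, one_mul]

lemma affineHom_base (u : Rˣ) (f : ℤ →₀ ZMod 2) :
    affineHom u (base f) = Equiv.addLeft (lampEval u f) := by
  simp [affineHom, base]

lemma lampEval_cyclotomicLamp_ne_zero [IsDomain R] (u : Rˣ) {D : ℕ} (hD : D < orderOf u) :
    lampEval u (cyclotomicLamp D) ≠ 0 := by
  induction D with
  | zero => simp [cyclotomicLamp, lampEval_single]
  | succ D ih =>
    rw [cyclotomicLamp, map_sub, lampEval_translate, ← sub_one_mul]
    refine mul_ne_zero ?_ (ih (by omega))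
    rw [sub_ne_zero, zpow_natCast, Ne, Units.val_eq_one]
    exact pow_ne_one_of_lt_orderOf (by omega) hD

end Evaluation

lemma exists_affineHom_cyclotomicLamp_ne_one (D : ℕ) :
    ∃ (H : Type) (_ : Group H) (_ : Finite H) (φ : Lamplighter →* H),
      φ (base (cyclotomicLamp D)) ≠ 1 := by
  let K := GaloisField 2 (D + 2)
  have : Fintype K := Fintype.ofFinite K
  obtain ⟨u, hu⟩ := IsCyclic.exists_generator (α := Kˣ)
  have hord : D < orderOf u := by
    rw [orderOf_eq_card_of_forall_mem_zpowers hu, Nat.card_units, GaloisField.card _ _ (by omega)]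
    have := (D + 2).lt_two_pow_self
    omega
  refine ⟨Equiv.Perm K, inferInstance, inferInstance, affineHom u, fun h => ?_⟩
  rw [affineHom_base] at h
  have := Equiv.congr_fun h 0
  simp only [Equiv.coe_addLeft, add_zero, Equiv.Perm.coe_one, id_eq] at this
  exact lampEval_cyclotomicLamp_ne_zero u hord this

lemma base_cyclotomicLamp_ne_one (D : ℕ) : base (cyclotomicLamp D) ≠ 1 := by
  obtain ⟨H, _, _, φ, hφ⟩ := exists_affineHom_cyclotomicLamp_ne_one D
  exact fun h => hφ (by rw [h, map_one])

lemma lt_farbD_base_cyclotomicLamp (D : ℕ) : D < farbD (base (cyclotomicLamp D)) := by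
  obtain ⟨H, _, _, φ, hφ⟩ := exists_affineHom_cyclotomicLamp_ne_one D
  obtain ⟨N, hN, hfin, hgN, hk⟩ := Nat.sInf_mem (s := {k | ∃ N : Subgroup Lamplighter, N.Normal ∧
    N.FiniteIndex ∧ base (cyclotomicLamp D) ∉ N ∧ N.index = k})
    ⟨_, φ.ker, inferInstance, inferInstance, hφ, rfl⟩
  by_contra! h
  exact hgN (base_cyclotomicLamp_mem hfin.index_ne_zero (hk.trans_le h))

end Lamplighter

lemma ceil_log_sq_le {n k : ℕ} (hk : 1 ≤ k) (hn : n < (k + 1) ^ 4) :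
    ⌈(Real.log n) ^ 2⌉₊ ≤ 128 * k := by
  rcases Nat.eq_zero_or_pos n with rfl | hpos
  · simp
  rw [Nat.ceil_le]
  have hk' : (1 : ℝ) ≤ k := by exact_mod_cast hk
  have hlog : Real.log n ≤ 4 * Real.log (k + 1) := by
    have : Real.log n ≤ Real.log ((k + 1 : ℝ) ^ 4) :=
      Real.log_le_log (by exact_mod_cast hpos) (by exact_mod_cast hn.le)
    simpa [Real.log_pow] using this
  have hsqrt : Real.log (k + 1) ≤ 2 * Real.sqrt (k + 1) := by
    have := Real.log_le_self (Real.sqrt_nonneg ((k : ℝ) + 1))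
    rw [Real.log_sqrt (by positivity)] at this
    linarith
  have h0 : 0 ≤ Real.log n := Real.log_natCast_nonneg n
  have hs := Real.sq_sqrt (show (0 : ℝ) ≤ k + 1 by positivity)
  calc Real.log n ^ 2 ≤ (8 * Real.sqrt ((k : ℝ) + 1)) ^ 2 := by gcongr; linarith
    _ = 64 * ((k : ℝ) + 1) := by rw [mul_pow, hs]; norm_num
    _ ≤ ((128 * k : ℕ) : ℝ) := by push_cast; linarith

/-- the normal Farb growth of the lamplighter group is
`≽ (log n)²` for every finite generating set. -/
theorem farb_growth_lower_bound_lamplighter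
    (X : Finset Lamplighter) (hX : Subgroup.closure (X : Set Lamplighter) = ⊤) :
    FarbPreceq (fun n => ⌈(Real.log n) ^ 2⌉₊) (farbF (X : Set Lamplighter)) := by
  obtain ⟨B, hB, ha, ht⟩ : ∃ B, 0 < B ∧
      wordLength (X : Set Lamplighter) (Lamplighter.base (Finsupp.single 0 1)) ≤ B ∧
      wordLength (X : Set Lamplighter) Lamplighter.step ≤ B :=
    ⟨_ + _ + 1, Nat.succ_pos _, (Nat.le_add_right _ _).trans (Nat.le_succ _),
      (Nat.le_add_left _ _).trans (Nat.le_succ _)⟩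
  refine ⟨128 * (3 * B), by positivity, fun n => ?_⟩
  rcases Nat.eq_zero_or_pos n with rfl | hn
  · simp
  obtain ⟨D, hD⟩ : ∃ D, n.sqrt.sqrt = D + 1 :=
    ⟨n.sqrt.sqrt - 1, by
      have := Nat.sqrt_pos.2 (Nat.sqrt_pos.2 hn)
      omega⟩
  have hle : (D + 1) ^ 4 ≤ n := by
    rw [← hD]
    calc n.sqrt.sqrt ^ 4 = (n.sqrt.sqrt ^ 2) ^ 2 := by ring
      _ ≤ n.sqrt ^ 2 := by gcongr; exact Nat.sqrt_le' _
      _ ≤ n := Nat.sqrt_le' _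
  have hlt : n < (D + 1 + 1) ^ 4 := by
    rw [← hD]
    calc n < (n.sqrt + 1) ^ 2 := Nat.lt_succ_sqrt' n
      _ ≤ ((n.sqrt.sqrt + 1) ^ 2) ^ 2 := by gcongr; exact Nat.lt_succ_sqrt' _
      _ = (n.sqrt.sqrt + 1) ^ 4 := by ring
  have hlen := Lamplighter.wordLength_base_le hX ha ht _ _ (Lamplighter.cyclotomicLamp_support D)
  have hbound : (D + 1) ^ 2 * (B * (2 * (D + 1) ^ 2 + 1)) ≤ 128 * (3 * B) * n :=
    calc _ ≤ (D + 1) ^ 2 * (B * (2 * (D + 1) ^ 2 + (D + 1) ^ 2)) := by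
          gcongr; exact Nat.one_le_pow _ _ (Nat.succ_pos D)
      _ = 3 * B * (D + 1) ^ 4 := by ring
      _ ≤ 128 * (3 * B) * n := Nat.mul_le_mul (by omega) hle
  have hF := (Lamplighter.lt_farbD_base_cyclotomicLamp D).trans_le
    (farbD_le_farbF X.finite_toSet hX (Lamplighter.base_cyclotomicLamp_ne_one D)
      (hlen.trans hbound))
  calc ⌈(Real.log n) ^ 2⌉₊ ≤ 128 * (D + 1) := ceil_log_sq_le (Nat.succ_pos D) hlt
    _ ≤ 128 * (3 * B) * farbF (X : Set Lamplighter) (128 * (3 * B) * n) := by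
      gcongr
      · omega
      · exact hF
end

section
/- Let n ≥ 2, let p be a prime and k ≥ 1. Then the center of the group SL_n(ℤ/p^kℤ) consists exactly of the scalar matrices ζ·I with ζ ∈ (ℤ/p^kℤ)ˣ satisfying ζ^n = 1. Moreover, if p is odd, then the order of the center of SL_n(ℤ/p^kℤ) divides n. (Corollaries 3.2 and 3.3 instantiated at G = SL_n, where ord(Z(SL_n)) = n.) -/
/-- the center of `SL_n(ℤ/p^kℤ)` consists exactly of the scalar
matrices `ζ·I` with `ζ^n = 1`; moreover for odd `p` the order of the center
divides `n`. -/
theorem center_SL_zmod_pow (n : ℕ) (hn : 2 ≤ n) (p : ℕ) (hp : p.Prime)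
    (k : ℕ) (hk : 1 ≤ k) :
    (∀ A : Matrix.SpecialLinearGroup (Fin n) (ZMod (p ^ k)),
        A ∈ Subgroup.center (Matrix.SpecialLinearGroup (Fin n) (ZMod (p ^ k))) ↔
          ∃ ζ : ZMod (p ^ k), ζ ^ n = 1 ∧
            (A : Matrix (Fin n) (Fin n) (ZMod (p ^ k))) = ζ • (1 : Matrix (Fin n) (Fin n) (ZMod (p ^ k)))) ∧
    (Odd p →
      Nat.card (Subgroup.center (Matrix.SpecialLinearGroup (Fin n) (ZMod (p ^ k)))) ∣ n) := by
  refine ⟨fun A ↦ ?_, fun hodd ↦ ?_⟩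
  · rw [Matrix.SpecialLinearGroup.mem_center_iff, Fintype.card_fin]
    simp only [Matrix.scalar_apply, Matrix.smul_one_eq_diagonal, eq_comm]
  · have hp2 : p ≠ 2 := by rintro rfl; exact absurd hodd (by decide)
    have : NeZero (p ^ k) := ⟨pow_ne_zero k hp.ne_zero⟩
    have := ZMod.isCyclic_units_of_prime_pow p hp hp2 k
    rw [Nat.card_congr (Matrix.SpecialLinearGroup.center_equiv_rootsOfUnity
        (n := Fin n) (R := ZMod (p ^ k))).toEquiv, Fintype.card_fin, max_eq_left (by lia)]
    have hcard : Nat.card (rootsOfUnity n (ZMod (p ^ k))) = _ :=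
      IsCyclic.card_powMonoidHom_ker (G := (ZMod (p ^ k))ˣ) n
    exact hcard ▸ Nat.gcd_dvd_right _ _
end

section
/- Let n ≥ 2, let p be a prime and k ≥ 2. The natural ring projection ℤ/p^kℤ → ℤ/p^{k−1}ℤ induces a surjective group homomorphism SL_n(ℤ/p^kℤ) → SL_n(ℤ/p^{k−1}ℤ). Moreover, if p does not divide n, this homomorphism restricts to an isomorphism from the center of SL_n(ℤ/p^kℤ) onto the center of SL_n(ℤ/p^{k−1}ℤ). (Lemma 3.4 instantiated at G = SL_n.) -/
/-- Entrywise reduction `SL_n(ℤ/bℤ) → SL_n(ℤ/aℤ)` for `a ∣ b`. -/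
def slRed (n : ℕ) {a b : ℕ} (h : a ∣ b) :
    Matrix.SpecialLinearGroup (Fin n) (ZMod b) →* Matrix.SpecialLinearGroup (Fin n) (ZMod a) :=
  Matrix.SpecialLinearGroup.map (ZMod.castHom h (ZMod a))

theorem one_add_pow_of_mul_self_eq_zero {R : Type*} [CommRing R] {x : R} (hx : x * x = 0)
    (m : ℕ) : (1 + x) ^ m = 1 + m * x := by
  induction m with
  | zero => simp
  | succ m ih =>
    rw [pow_succ, ih]
    push_cast
    linear_combination (m : R) * hx

section SquareZero

variable {R S : Type*} [CommRing R] [CommRing S] {f : S →+* R}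

/-- A special linear matrix lifts along a surjection with square-zero kernel: lift its entries
and rescale one row by the inverse of the determinant. -/
theorem Matrix.SpecialLinearGroup.map_surjective_of_ker_mul_self {ι : Type*} [Fintype ι]
    [DecidableEq ι] (hf : Function.Surjective f) (hker : ∀ x, f x = 0 → x * x = 0) :
    Function.Surjective (Matrix.SpecialLinearGroup.map (n := ι) f) := by
  intro M
  rcases isEmpty_or_nonempty ι with h | ⟨⟨i⟩⟩
  · exact ⟨1, Subsingleton.elim _ _⟩
  choose g hg using hf
  let A : Matrix ι ι S := Matrix.of fun a b => g (M a b)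
  have hA : A.map f = M := by
    ext a b
    simp [A, hg]
  have hdet : f A.det = 1 := by
    rw [RingHom.map_det, RingHom.mapMatrix_apply, hA, M.det_coe]
  have hsq := hker (A.det - 1) (by simp [hdet])
  have hB : (A.updateRow i ((2 - A.det) • A i)).det = 1 := by
    rw [Matrix.det_updateRow_smul, Matrix.updateRow_eq_self]
    linear_combination -hsq
  have h_scale : f (2 - A.det) = 1 := by
    rw [map_sub, hdet, map_ofNat]
    norm_num
  refine ⟨⟨_, hB⟩, ?_⟩
  ext a b
  rw [← hA]
  change f (A.updateRow i ((2 - A.det) • A i) a b) = f (A a b)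
  by_cases hai : a = i
  · subst hai
    rw [Matrix.updateRow_self, Pi.smul_apply, smul_eq_mul, map_mul, h_scale, one_mul]
  · rw [Matrix.updateRow_ne hai]

theorem eq_of_map_eq_of_pow_eq_one {m : ℕ} (hker : ∀ x, f x = 0 → x * x = 0)
    (hm : IsUnit (m : S)) {r s : S} (hr : r ^ m = 1) (hs : s ^ m = 1) (h : f r = f s) :
    r = s := by
  rcases m with _ | m
  · have : Subsingleton S :=
      isUnit_zero_iff.mp (by simpa using hm) |> subsingleton_of_zero_eq_one
    exact Subsingleton.elim _ _
  have hx : f (r * s ^ m - 1) = 0 := by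
    rw [map_sub, map_mul, h, ← map_mul, ← pow_succ', hs, sub_self]
  have hpow := one_add_pow_of_mul_self_eq_zero (hker _ hx) (m + 1)
  rw [add_sub_cancel, mul_pow, hr, ← pow_mul, mul_comm m, pow_mul, hs, one_pow, mul_one,
    left_eq_add, hm.mul_right_eq_zero] at hpow
  rw [pow_succ] at hs
  linear_combination s * hpow - r * hs

theorem exists_map_eq_of_pow_eq_one {m : ℕ} (hf : Function.Surjective f)
    (hker : ∀ x, f x = 0 → x * x = 0) (hm : IsUnit (m : S)) {r : R} (hr : r ^ m = 1) :
    ∃ s : S, s ^ m = 1 ∧ f s = r := by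
  obtain ⟨s, rfl⟩ := hf r
  obtain ⟨c, hc⟩ := hm.exists_right_inv
  have he : f (s ^ m - 1) = 0 := by simp [hr]
  have hsq := hker _ he
  have hx : f (-(c * (s ^ m - 1))) = 0 := by rw [map_neg, map_mul, he, mul_zero, neg_zero]
  refine ⟨s * (1 + -(c * (s ^ m - 1))), ?_, by rw [map_mul, map_add, hx]; simp⟩
  rw [mul_pow, one_add_pow_of_mul_self_eq_zero (hker _ hx)]
  linear_combination -hsq - s ^ m * (s ^ m - 1) * hc

theorem Matrix.SpecialLinearGroup.map_bijOn_center_of_ker_mul_self {ι : Type*} [Fintype ι]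
    [DecidableEq ι] (hf : Function.Surjective f) (hker : ∀ x, f x = 0 → x * x = 0)
    (hι : IsUnit (Fintype.card ι : S)) :
    Set.BijOn (Matrix.SpecialLinearGroup.map (n := ι) f)
      (Subgroup.center (Matrix.SpecialLinearGroup ι S) : Set _)
      (Subgroup.center (Matrix.SpecialLinearGroup ι R) : Set _) := by
  refine ⟨fun A hA => ?_, fun A hA B hB hAB => ?_, fun B hB => ?_⟩
  · obtain ⟨r, hr, hrA⟩ := Matrix.SpecialLinearGroup.mem_center_iff.mp hA
    refine Matrix.SpecialLinearGroup.mem_center_iff.mpr ⟨f r, by rw [← map_pow, hr, map_one], ?_⟩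
    rw [Matrix.SpecialLinearGroup.map_apply_coe, ← hrA]
    simp [Matrix.diagonal_map]
  · obtain ⟨r, hr, hrA⟩ := Matrix.SpecialLinearGroup.mem_center_iff.mp hA
    obtain ⟨s, hs, hsB⟩ := Matrix.SpecialLinearGroup.mem_center_iff.mp hB
    rcases isEmpty_or_nonempty ι with h | ⟨⟨i⟩⟩
    · exact Subsingleton.elim _ _
    have hfrs : f r = f s := by
      have := congrArg (fun M : Matrix.SpecialLinearGroup ι R => M i i) hAB
      simpa [Matrix.SpecialLinearGroup.map_apply_coe, ← hrA, ← hsB] using this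
    apply Subtype.ext
    rw [← hrA, ← hsB, eq_of_map_eq_of_pow_eq_one hker hι hr hs hfrs]
  · obtain ⟨r, hr, hrB⟩ := Matrix.SpecialLinearGroup.mem_center_iff.mp hB
    obtain ⟨s, hs, rfl⟩ := exists_map_eq_of_pow_eq_one hf hker hι hr
    have hdet : (Matrix.scalar ι s).det = 1 := by
      rw [Matrix.scalar_apply, Matrix.det_diagonal, Finset.prod_const, Finset.card_univ, hs]
    refine ⟨⟨_, hdet⟩, Matrix.SpecialLinearGroup.mem_center_iff.mpr ⟨s, hs, rfl⟩, ?_⟩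
    apply Subtype.ext
    rw [← hrB]
    change (Matrix.scalar ι s).map f = Matrix.scalar ι (f s)
    simp [Matrix.diagonal_map]

end SquareZero

theorem ZMod.mul_self_eq_zero_of_castHom_eq_zero {a b : ℕ} (h : a ∣ b) (hab : b ∣ a * a)
    (x : ZMod b) (hx : ZMod.castHom h (ZMod a) x = 0) : x * x = 0 := by
  obtain ⟨z, rfl⟩ := ZMod.intCast_surjective x
  rw [map_intCast, ZMod.intCast_zmod_eq_zero_iff_dvd] at hx
  rw [← Int.cast_mul, ZMod.intCast_zmod_eq_zero_iff_dvd]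
  exact (Int.natCast_dvd_natCast.mpr hab).trans (by
    rw [Nat.cast_mul]
    exact mul_dvd_mul hx hx)

/-- the reduction `SL_n(ℤ/p^kℤ) → SL_n(ℤ/p^{k−1}ℤ)` is
surjective, and when `p ∤ n` it restricts to an isomorphism (a bijection)
between the centers. -/
theorem slRed_surjective_and_bijOn_center (n : ℕ) (hn : 2 ≤ n) (p : ℕ) (hp : p.Prime)
    (k : ℕ) (hk : 2 ≤ k) :
    Function.Surjective (slRed n (pow_dvd_pow p (Nat.sub_le k 1))) ∧
      (¬ p ∣ n →
        Set.BijOn (slRed n (pow_dvd_pow p (Nat.sub_le k 1)))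
          (Subgroup.center (Matrix.SpecialLinearGroup (Fin n) (ZMod (p ^ k))) : Set _)
          (Subgroup.center (Matrix.SpecialLinearGroup (Fin n) (ZMod (p ^ (k - 1)))) : Set _)) := by
  have hf := ZMod.castHom_surjective (pow_dvd_pow p (Nat.sub_le k 1))
  have hker := ZMod.mul_self_eq_zero_of_castHom_eq_zero (pow_dvd_pow p (Nat.sub_le k 1)) (by
    rw [← pow_add]
    exact pow_dvd_pow p (by omega))
  refine ⟨Matrix.SpecialLinearGroup.map_surjective_of_ker_mul_self hf hker, fun hpn =>
    Matrix.SpecialLinearGroup.map_bijOn_center_of_ker_mul_self hf hker ?_⟩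
  rw [Fintype.card_fin, ZMod.isUnit_iff_coprime]
  exact ((hp.coprime_iff_not_dvd.mpr hpn).pow_left k).symm
end

section
/- Let n ≥ 2. There exists a prime p₀ (depending only on n) such that for every prime p ≥ p₀ and every k ≥ 1, the quotient group SL_n(ℤ/p^kℤ)/Z(SL_n(ℤ/p^kℤ)) has trivial center, where Z(·) denotes the center. (Corollary 3.5 instantiated at the simply-connected Chevalley group SL_n.) -/
/-- If the size of the matrices is invertible in `R`, then `SL_n(R)` modulo its center has trivial
center: comparing traces, an element that is central modulo the center commutes with every
transvection. -/
theorem Matrix.SpecialLinearGroup.center_quotient_center_eq_bot {ι R : Type*} [Fintype ι]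
    [DecidableEq ι] [CommRing R] (h : IsUnit (Fintype.card ι : R)) :
    Subgroup.center (Matrix.SpecialLinearGroup ι R ⧸
      Subgroup.center (Matrix.SpecialLinearGroup ι R)) = ⊥ := by
  rw [eq_bot_iff]
  intro x hx
  induction x using QuotientGroup.induction_on with
  | H A =>
    rw [Subgroup.mem_bot, QuotientGroup.eq_one_iff]
    obtain ⟨r, hr⟩ := Matrix.mem_range_scalar_of_commute_transvectionStruct
      (M := (A : Matrix ι ι R)) fun t => by
        let T : Matrix.SpecialLinearGroup ι R := ⟨t.toMatrix, t.det⟩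
        have hTA := Subgroup.mem_center_iff.mp hx (T : Matrix.SpecialLinearGroup ι R ⧸ _)
        rw [← QuotientGroup.mk_mul, ← QuotientGroup.mk_mul, QuotientGroup.eq] at hTA
        obtain ⟨z, -, hz⟩ := Matrix.SpecialLinearGroup.mem_center_iff.mp hTA
        have hmul : A * T = T * A * ((T * A)⁻¹ * (A * T)) := by group
        have hmat : (A : Matrix ι ι R) * T = z • ((T : Matrix ι ι R) * A) := by
          have := congrArg (fun B : Matrix.SpecialLinearGroup ι R => (B : Matrix ι ι R)) hmul
          simp only [Matrix.SpecialLinearGroup.coe_mul (T * A), ← hz] at this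
          simpa [Matrix.smul_eq_mul_diagonal] using this
        have hconj : (T : Matrix ι ι R) = z • ((A⁻¹ * T * A : Matrix.SpecialLinearGroup ι R) :
            Matrix ι ι R) := by
          have : (T : Matrix ι ι R) = (A⁻¹ : Matrix.SpecialLinearGroup ι R) * (A * T) := by
            rw [← Matrix.SpecialLinearGroup.coe_mul, ← Matrix.SpecialLinearGroup.coe_mul,
              inv_mul_cancel_left]
          rw [this, hmat, Matrix.mul_smul, ← Matrix.SpecialLinearGroup.coe_mul,
            ← Matrix.SpecialLinearGroup.coe_mul, mul_assoc]
        have hinv : (A : Matrix ι ι R) * (A⁻¹ : Matrix.SpecialLinearGroup ι R) = 1 := by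
          rw [← Matrix.SpecialLinearGroup.coe_mul, mul_inv_cancel,
            Matrix.SpecialLinearGroup.coe_one]
        have htrace : Matrix.trace (T : Matrix ι ι R) = Fintype.card ι := by
          change Matrix.trace (1 + Matrix.single t.i t.j t.c) = _
          rw [Matrix.trace_add, Matrix.trace_one, Matrix.trace_single_eq_of_ne _ _ _ t.hij,
            add_zero]
        have hz1 : z = 1 := by
          have := congrArg Matrix.trace hconj
          rw [Matrix.trace_smul, Matrix.SpecialLinearGroup.coe_mul,
            Matrix.SpecialLinearGroup.coe_mul, Matrix.trace_mul_comm, ← Matrix.mul_assoc, hinv,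
            Matrix.one_mul, htrace, smul_eq_mul] at this
          exact h.mul_right_cancel (by rw [← this, one_mul])
        rw [hz1, one_smul] at hmat
        exact hmat.symm
    refine Subgroup.mem_center_iff.mpr fun B => Subtype.ext ?_
    rw [Matrix.SpecialLinearGroup.coe_mul, Matrix.SpecialLinearGroup.coe_mul, ← hr]
    exact (Matrix.scalar_commute r (Commute.all r) _).eq.symm

/-- for all sufficiently large primes `p` and all `k ≥ 1`, the
group `SL_n(ℤ/p^kℤ)/Z(SL_n(ℤ/p^kℤ))` has trivial center. -/
theorem center_quotient_center_SL_trivial (n : ℕ) (hn : 2 ≤ n) :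
    ∃ p₀ : ℕ, p₀.Prime ∧
      ∀ p : ℕ, p.Prime → p₀ ≤ p → ∀ k : ℕ, 1 ≤ k →
        Subgroup.center
          (Matrix.SpecialLinearGroup (Fin n) (ZMod (p ^ k)) ⧸
            Subgroup.center (Matrix.SpecialLinearGroup (Fin n) (ZMod (p ^ k)))) = ⊥ := by
  obtain ⟨p₀, hle, hp₀⟩ := Nat.exists_infinite_primes (n + 1)
  refine ⟨p₀, hp₀, fun p hp hpp k _ => ?_⟩
  apply Matrix.SpecialLinearGroup.center_quotient_center_eq_bot
  rw [Fintype.card_fin, ZMod.isUnit_iff_coprime]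
  exact (Nat.coprime_of_lt_prime (by omega) (by omega) hp).symm.pow_right k
end

section
/- Let n ≥ 2 and for a prime p and k ≥ 1 write G_k = SL_n(ℤ/p^kℤ), Z(G_k) for its center, and G_k^i = ker(SL_n(ℤ/p^kℤ) → SL_n(ℤ/p^iℤ)) for 0 ≤ i ≤ k. There exists a prime p₀ (depending only on n) such that for every prime p ≥ p₀, every k ≥ 2, every i with 0 ≤ i ≤ k−2, and every g ∈ G_k^i with g ∉ G_k^{i+1}·Z(G_k), there exists h ∈ G_k^1 such that hgh⁻¹g⁻¹ ∈ G_k^{i+1} and hgh⁻¹g⁻¹ ∉ G_k^{i+2}·Z(G_k). (Lemma 3.9 instantiated at G = SL_n.) -/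
open scoped Pointwise

/-- The congruence filtration subgroup `G_k^i = ker(SL_n(ℤ/p^kℤ) → SL_n(ℤ/p^iℤ))`. -/
abbrev slCongKer (n p k i : ℕ) (h : i ≤ k) :
    Subgroup (Matrix.SpecialLinearGroup (Fin n) (ZMod (p ^ k))) :=
  (slRed n (pow_dvd_pow p h)).ker

theorem mem_slCongKer_iff {n p k i : ℕ} {h : i ≤ k}
    {g : Matrix.SpecialLinearGroup (Fin n) (ZMod (p ^ k))} :
    g ∈ slCongKer n p k i h ↔
      (g : Matrix (Fin n) (Fin n) (ZMod (p ^ k))).map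
        (ZMod.castHom (pow_dvd_pow p h) (ZMod (p ^ i))) = 1 :=
  MonoidHom.mem_ker.trans Subtype.ext_iff

theorem slCongKer_anti {n p k i j : ℕ} (hij : i ≤ j) (hj : j ≤ k) :
    slCongKer n p k j hj ≤ slCongKer n p k i (hij.trans hj) := by
  intro g hg
  rw [mem_slCongKer_iff] at hg ⊢
  ext r s
  have hrs := congrArg (ZMod.castHom (pow_dvd_pow p hij) (ZMod (p ^ i))) (congr_fun₂ hg r s)
  rw [Matrix.map_apply, ← RingHom.comp_apply, ZMod.castHom_comp] at hrs
  rw [Matrix.map_apply, hrs, ← Matrix.map_apply (f := ZMod.castHom _ _),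
    Matrix.map_one _ (map_zero _) (map_one _)]

theorem ZMod.castHom_pow_eq_zero_iff_dvd {p k i : ℕ} [NeZero (p ^ k)] (h : i ≤ k)
    (x : ZMod (p ^ k)) :
    ZMod.castHom (pow_dvd_pow p h) (ZMod (p ^ i)) x = 0 ↔ p ^ i ∣ x.val := by
  conv_lhs => rw [← ZMod.natCast_zmod_val x]
  rw [map_natCast, ZMod.natCast_eq_zero_iff]

theorem ZMod.castHom_pow_succ_mul_eq_zero_iff {p k j : ℕ} (hp : 0 < p) (h : j + 1 ≤ k)
    (x : ZMod (p ^ k)) :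
    ZMod.castHom (pow_dvd_pow p h) (ZMod (p ^ (j + 1))) (p * x) = 0 ↔
      ZMod.castHom (pow_dvd_pow p (Nat.le_of_succ_le h)) (ZMod (p ^ j)) x = 0 := by
  have : NeZero (p ^ k) := ⟨(pow_pos hp k).ne'⟩
  rw [ZMod.castHom_pow_eq_zero_iff_dvd (Nat.le_of_succ_le h)]
  conv_lhs => rw [← ZMod.natCast_zmod_val x]
  rw [← Nat.cast_mul, map_natCast, ZMod.natCast_eq_zero_iff, pow_succ',
    Nat.mul_dvd_mul_iff_left hp]

theorem ZMod.pow_eq_one_of_castHom_eq_one {p k j : ℕ} (hp : 0 < p) (hj : 1 ≤ j) (h : j ≤ k)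
    {x : ZMod (p ^ k)} (hx : ZMod.castHom (pow_dvd_pow p h) (ZMod (p ^ j)) x = 1) :
    x ^ p ^ k = 1 := by
  have : NeZero (p ^ k) := ⟨(pow_pos hp k).ne'⟩
  have hdvd : (p : ZMod (p ^ k)) ∣ x - 1 := by
    have h0 : ZMod.castHom (pow_dvd_pow p h) (ZMod (p ^ j)) (x - 1) = 0 := by
      rw [map_sub, hx, map_one, sub_self]
    rw [ZMod.castHom_pow_eq_zero_iff_dvd h] at h0
    rw [← ZMod.natCast_zmod_val (x - 1)]
    exact Nat.cast_dvd_cast ((dvd_pow_self p (by omega)).trans h0)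
  have hpow := (pow_dvd_pow (p : ZMod (p ^ k)) (Nat.le_succ k)).trans
    (dvd_sub_pow_of_dvd_sub hdvd k)
  rw [← Nat.cast_pow, ZMod.natCast_self, zero_dvd_iff, one_pow, sub_eq_zero] at hpow
  exact hpow

/-- Roots of unity of order prime to `p` lift along `ℤ/p^kℤ → ℤ/p^jℤ`. -/
theorem ZMod.exists_pow_eq_one_castHom_eq {n p k j : ℕ} (hp : 0 < p) (hn : 1 < n)
    (hpn : p.Coprime n) (hj : 1 ≤ j) (h : j ≤ k) {c : ZMod (p ^ j)} (hc : c ^ n = 1) :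
    ∃ d : ZMod (p ^ k), d ^ n = 1 ∧ ZMod.castHom (pow_dvd_pow p h) (ZMod (p ^ j)) d = c := by
  obtain ⟨d, rfl⟩ := ZMod.castHom_surjective (pow_dvd_pow p h) c
  obtain ⟨s, -, hs⟩ := Nat.exists_mul_mod_eq_one_of_coprime (hpn.pow_left k) hn
  refine ⟨d ^ (p ^ k * s), ?_, ?_⟩
  · have hd : (d ^ n) ^ p ^ k = 1 :=
      ZMod.pow_eq_one_of_castHom_eq_one hp hj h (by rw [map_pow, hc])
    rw [← pow_mul, mul_comm, ← mul_assoc, pow_mul, pow_mul, hd, one_pow]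
  · rw [map_pow, ← Nat.div_add_mod (p ^ k * s) n, hs, pow_succ, pow_mul, hc, one_pow, one_mul]

open Matrix in
theorem mul_mul_inv_mul_inv_transvection_mem_slCongKer_iff {n p k j : ℕ} (hp : 0 < p)
    (hj : j + 1 ≤ k) {a b : Fin n} (hab : a ≠ b)
    (g : Matrix.SpecialLinearGroup (Fin n) (ZMod (p ^ k))) :
    Matrix.SpecialLinearGroup.transvection hab (p : ZMod (p ^ k)) * g *
        (Matrix.SpecialLinearGroup.transvection hab (p : ZMod (p ^ k)))⁻¹ * g⁻¹ ∈
          slCongKer n p k (j + 1) hj ↔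
      Commute (single a b 1) ((g : Matrix (Fin n) (Fin n) (ZMod (p ^ k))).map
        (ZMod.castHom (pow_dvd_pow p (Nat.le_of_succ_le hj)) (ZMod (p ^ j)))) := by
  set φ := ZMod.castHom (pow_dvd_pow p hj) (ZMod (p ^ (j + 1)))
  set ψ := ZMod.castHom (pow_dvd_pow p (Nat.le_of_succ_le hj)) (ZMod (p ^ j))
  set t := Matrix.SpecialLinearGroup.transvection hab (p : ZMod (p ^ k)) with ht
  set M : Matrix (Fin n) (Fin n) (ZMod (p ^ k)) := g.1
  set E : Matrix (Fin n) (Fin n) (ZMod (p ^ k)) := single a b 1 with hE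
  have htM : (t : Matrix (Fin n) (Fin n) (ZMod (p ^ k))) = 1 + (p : ZMod (p ^ k)) • E := by
    rw [ht, Matrix.SpecialLinearGroup.transvection_coe, hE, smul_single, smul_eq_mul, mul_one]
  have hsub : (t * g : Matrix.SpecialLinearGroup (Fin n) (ZMod (p ^ k))).1 - (g * t).1 =
      (p : ZMod (p ^ k)) • (E * M - M * E) := by
    change (t : Matrix (Fin n) (Fin n) (ZMod (p ^ k))) * M - M * t = _
    rw [htM, add_mul, mul_add, smul_mul_assoc, mul_smul_comm, one_mul, mul_one, smul_sub]
    abel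
  have hcomm : Commute (single a b 1) (M.map ψ) ↔ ∀ r s, ψ ((E * M - M * E) r s) = 0 := by
    have hEψ : (single a b 1 : Matrix (Fin n) (Fin n) (ZMod (p ^ j))) = E.map ψ := by
      rw [hE, Matrix.map_single, map_one]
    rw [hEψ, Commute, SemiconjBy, ← Matrix.map_mul, ← Matrix.map_mul, ← Matrix.ext_iff]
    simp only [Matrix.map_apply, Matrix.sub_apply, map_sub, sub_eq_zero]
  rw [MonoidHom.mem_ker, map_mul, map_mul, map_inv, map_inv, mul_inv_eq_one, mul_inv_eq_iff_eq_mul,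
    ← map_mul, hcomm, Matrix.SpecialLinearGroup.ext_iff]
  refine forall₂_congr fun r s => ?_
  rw [← ZMod.castHom_pow_succ_mul_eq_zero_iff hp hj]
  change φ ((t * g).1 r s) = φ ((g * t).1 r s) ↔ _
  rw [← sub_eq_zero, ← map_sub, ← Matrix.sub_apply, hsub]
  rfl

open Matrix in
theorem mem_slCongKer_of_mem_mul_center {n p k i j : ℕ} (hp : 0 < p) (hpn : p.Coprime n)
    (hi : 1 ≤ i) (hij : i ≤ j) (hj : j ≤ k) {x : Matrix.SpecialLinearGroup (Fin n) (ZMod (p ^ k))}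
    (hx : x ∈ slCongKer n p k i (hij.trans hj))
    (hxz : x ∈ (↑(slCongKer n p k j hj) *
      ↑(Subgroup.center (Matrix.SpecialLinearGroup (Fin n) (ZMod (p ^ k)))) :
      Set (Matrix.SpecialLinearGroup (Fin n) (ZMod (p ^ k))))) :
    x ∈ slCongKer n p k j hj := by
  obtain ⟨u, hu, z, hz, rfl⟩ := Set.mem_mul.1 hxz
  have hz' := (Subgroup.mul_mem_cancel_left _ (slCongKer_anti hij hj hu)).1 hx
  suffices z = 1 by rw [this, mul_one]; exact hu
  obtain ⟨c, hc, hcz⟩ := Matrix.SpecialLinearGroup.mem_center_iff.1 hz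
  rw [Fintype.card_fin] at hc
  rw [mem_slCongKer_iff, ← hcz] at hz'
  rcases isEmpty_or_nonempty (Fin n) with _ | ⟨⟨r⟩⟩
  · exact Subsingleton.elim _ _
  have hc1 := congr_fun₂ hz' r r
  rw [Matrix.map_apply, scalar_apply, diagonal_apply_eq, one_apply_eq] at hc1
  have hcp := ZMod.pow_eq_one_of_castHom_eq_one hp hi (hij.trans hj) hc1
  obtain rfl : c = 1 := (pow_eq_one_iff_of_coprime (hpn.pow_left k)).1 ⟨hcp, hc⟩
  refine Subtype.ext ?_
  rw [← hcz, map_one]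
  rfl

open Matrix in
theorem mem_slCongKer_mul_center_of_commute_single {n p k j : ℕ} (hp : 0 < p) (hn : 1 < n)
    (hpn : p.Coprime n) (hj1 : 1 ≤ j) (hj : j ≤ k)
    {g : Matrix.SpecialLinearGroup (Fin n) (ZMod (p ^ k))}
    (hg : Pairwise fun a b => Commute (single a b 1)
      ((g : Matrix (Fin n) (Fin n) (ZMod (p ^ k))).map
        (ZMod.castHom (pow_dvd_pow p hj) (ZMod (p ^ j))))) :
    g ∈ (↑(slCongKer n p k j hj) *
      ↑(Subgroup.center (Matrix.SpecialLinearGroup (Fin n) (ZMod (p ^ k)))) :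
      Set (Matrix.SpecialLinearGroup (Fin n) (ZMod (p ^ k)))) := by
  obtain ⟨c, hc⟩ := mem_range_scalar_of_commute_single hg
  have hcn : c ^ n = 1 := by
    have hdet := (slRed n (pow_dvd_pow p hj) g).2
    change ((g : Matrix (Fin n) (Fin n) (ZMod (p ^ k))).map
      (ZMod.castHom (pow_dvd_pow p hj) (ZMod (p ^ j)))).det = 1 at hdet
    simpa [← hc] using hdet
  obtain ⟨d, hd, hdc⟩ := ZMod.exists_pow_eq_one_castHom_eq hp hn hpn hj1 hj hcn
  let z : Matrix.SpecialLinearGroup (Fin n) (ZMod (p ^ k)) :=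
    ⟨scalar (Fin n) d, by simpa using hd⟩
  refine Set.mem_mul.2 ⟨g * z⁻¹, ?_, z, ?_, inv_mul_cancel_right g z⟩
  · rw [SetLike.mem_coe, MonoidHom.mem_ker, map_mul, map_inv, mul_inv_eq_one]
    refine Subtype.ext (Eq.trans hc.symm ?_)
    change _ = (scalar (Fin n) d).map (ZMod.castHom (pow_dvd_pow p hj) (ZMod (p ^ j)))
    rw [scalar_apply, scalar_apply, diagonal_map (map_zero _), ← hdc]
  · exact Matrix.SpecialLinearGroup.mem_center_iff.2 ⟨d, by rwa [Fintype.card_fin], rfl⟩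

/-- Lemma 3.9: for sufficiently large primes `p`, any
`g ∈ G_k^i \ G_k^{i+1}·Z(G_k)` admits `h ∈ G_k^1` with
`hgh⁻¹g⁻¹ ∈ G_k^{i+1} \ G_k^{i+2}·Z(G_k)`. -/
theorem commutator_descends_filtration_SL (n : ℕ) (hn : 2 ≤ n) :
    ∃ p₀ : ℕ, p₀.Prime ∧
      ∀ p : ℕ, p.Prime → p₀ ≤ p → ∀ k : ℕ, 2 ≤ k → ∀ i : ℕ, i ≤ k - 2 →
        ∀ (hik : i ≤ k) (hik1 : i + 1 ≤ k) (hik2 : i + 2 ≤ k) (hk1 : 1 ≤ k),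
        ∀ g ∈ slCongKer n p k i hik,
          g ∉ (↑(slCongKer n p k (i + 1) hik1) *
              ↑(Subgroup.center (Matrix.SpecialLinearGroup (Fin n) (ZMod (p ^ k)))) :
              Set (Matrix.SpecialLinearGroup (Fin n) (ZMod (p ^ k)))) →
          ∃ h ∈ slCongKer n p k 1 hk1,
            h * g * h⁻¹ * g⁻¹ ∈ slCongKer n p k (i + 1) hik1 ∧
            h * g * h⁻¹ * g⁻¹ ∉
              (↑(slCongKer n p k (i + 2) hik2) *
                ↑(Subgroup.center (Matrix.SpecialLinearGroup (Fin n) (ZMod (p ^ k)))) :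
                Set (Matrix.SpecialLinearGroup (Fin n) (ZMod (p ^ k)))) := by
  obtain ⟨p₀, hnp₀, hp₀⟩ := Nat.exists_infinite_primes (n + 1)
  refine ⟨p₀, hp₀, fun p hp hpp₀ k _ i _ hik hik1 hik2 hk1 g hg hgz => ?_⟩
  have hpn : p.Coprime n := Nat.coprime_of_lt_prime (by omega) (by omega) hp
  by_contra! hcon
  refine hgz (mem_slCongKer_mul_center_of_commute_single hp.pos hn hpn (by omega) hik1 ?_)
  intro a b hab
  have ht : Matrix.SpecialLinearGroup.transvection hab (p : ZMod (p ^ k)) ∈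
      slCongKer n p k 1 hk1 := by
    rw [mem_slCongKer_iff, Matrix.SpecialLinearGroup.transvection_coe,
      Matrix.map_add _ (map_add _), Matrix.map_single, map_natCast,
      (ZMod.natCast_eq_zero_iff p (p ^ 1)).2 (pow_one p).dvd, Matrix.single_zero, add_zero,
      Matrix.map_one _ (map_zero _) (map_one _)]
  have hi1 := (mul_mul_inv_mul_inv_transvection_mem_slCongKer_iff hp.pos hik1 hab g).2
    (by rw [mem_slCongKer_iff.1 hg]; exact Commute.one_right _)
  exact (mul_mul_inv_mul_inv_transvection_mem_slCongKer_iff hp.pos hik2 hab g).1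
    (mem_slCongKer_of_mem_mul_center hp.pos hpn (by omega) (Nat.le_succ _) hik2 hi1
      (hcon _ ht hi1))
end
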